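/- arXiv:1309.7941 — 12 statements merged into one kernel-verified Lean document; each statement's English description precedes it below -/
import Mathlib

section
/- Let P be a non-empty set of prime numbers such that (i) for every p in P, the number p-1 is squarefree, and (ii) for every p in P, every prime divisor q of p-1 also belongs to P. Then P is one of the four sets {2}, {2,3}, {2,3,7}, {2,3,7,43}. -/
/-- A squarefree number all of whose prime factors lie in a finite set divides the product of
that set. -/
theorem Squarefree.dvd_prod_of_primeFactors_subset {n : ℕ} (hn : Squarefree n) {s : Finset ℕ}
    (h : n.primeFactors ⊆ s) : n ∣ ∏ q ∈ s, q := by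
  rw [← Nat.prod_primeFactors_of_squarefree hn]
  exact Finset.prod_dvd_prod_of_subset _ _ _ h

theorem Nat.Prime.mem_of_pred_dvd {p : ℕ} (hp : p.Prime) (h : p - 1 ∣ 1806) :
    p = 2 ∨ p = 3 ∨ p = 7 ∨ p = 43 := by
  have hdiv : Nat.divisors 1806 =
      {1, 2, 3, 6, 7, 14, 21, 42, 43, 86, 129, 258, 301, 602, 903, 1806} := by
    decide +kernel
  have hmem : p - 1 ∈ Nat.divisors 1806 := Nat.mem_divisors.2 ⟨h, by norm_num⟩
  obtain ⟨m, rfl⟩ : ∃ m, p = m + 1 := ⟨p - 1, (Nat.sub_add_cancel hp.one_le).symm⟩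
  rw [hdiv, Nat.add_sub_cancel] at hmem
  simp only [Finset.mem_insert, Finset.mem_singleton] at hmem
  rcases hmem with rfl | rfl | rfl | rfl | rfl | rfl | rfl | rfl | rfl | rfl | rfl | rfl | rfl |
    rfl | rfl | rfl <;> revert hp <;> norm_num

theorem primes_with_squarefree_pred
    (P : Set ℕ) (hprime : ∀ p ∈ P, Nat.Prime p) (hne : P.Nonempty)
    (hsf : ∀ p ∈ P, Squarefree (p - 1))
    (hclosed : ∀ p ∈ P, ∀ q : ℕ, Nat.Prime q → q ∣ p - 1 → q ∈ P) :
    P = {2} ∨ P = {2, 3} ∨ P = {2, 3, 7} ∨ P = {2, 3, 7, 43} := by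
  have hall : ∀ p ∈ P, p = 2 ∨ p = 3 ∨ p = 7 ∨ p = 43 := by
    intro p
    induction p using Nat.strong_induction_on with
    | _ p ih =>
      intro hp
      have hsub : (p - 1).primeFactors ⊆ {2, 3, 7, 43} := by
        intro q hq
        have hqp : q < p :=
          (Nat.le_of_mem_primeFactors hq).trans_lt (Nat.sub_one_lt (hprime p hp).ne_zero)
        simpa using ih q hqp (hclosed p hp q (Nat.prime_of_mem_primeFactors hq)
          (Nat.dvd_of_mem_primeFactors hq))
      exact (hprime p hp).mem_of_pred_dvd
        (by simpa using (hsf p hp).dvd_prod_of_primeFactors_subset hsub)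
  have h43 : 43 ∈ P → 7 ∈ P := fun h => hclosed 43 h 7 (by norm_num) (by norm_num)
  have h7 : 7 ∈ P → 3 ∈ P := fun h => hclosed 7 h 3 (by norm_num) (by norm_num)
  have h3 : 3 ∈ P → 2 ∈ P := fun h => hclosed 3 h 2 (by norm_num) (by norm_num)
  have h2 : 2 ∈ P := by
    obtain ⟨p, hp⟩ := hne
    rcases hall p hp with rfl | rfl | rfl | rfl <;> tauto
  by_cases m3 : 3 ∈ P
  · by_cases m7 : 7 ∈ P
    · by_cases m43 : 43 ∈ P
      · right; right; right
        ext x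
        simp only [Set.mem_insert_iff, Set.mem_singleton_iff]
        grind
      · right; right; left
        ext x
        simp only [Set.mem_insert_iff, Set.mem_singleton_iff]
        grind
    · right; left
      ext x
      simp only [Set.mem_insert_iff, Set.mem_singleton_iff]
      grind
  · left
    ext x
    simp only [Set.mem_singleton_iff]
    grind
end

section
/- Let N be a set of positive integers such that (i) every element of N is squarefree, and (ii) for every element ν of N and every prime divisor p of ν, the number p-1 divides ν. Then N is a subset of {1, 2, 6, 42, 1806}. -/
/-- A squarefree number divides any nonzero number divisible by all of its prime factors. -/
theorem Squarefree.dvd_of_forall_prime_dvd {n m : ℕ} (hn : Squarefree n) (hm : m ≠ 0)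
    (h : ∀ p : ℕ, p.Prime → p ∣ n → p ∣ m) : n ∣ m := by
  rw [← Nat.prod_primeFactors_of_squarefree hn]
  refine (Finset.prod_dvd_prod_of_subset _ _ _ fun p hp => ?_).trans (Nat.prod_primeFactors_dvd m)
  have hp' := Nat.prime_of_mem_primeFactors hp
  exact Nat.mem_primeFactors.2 ⟨hp', h p hp' (Nat.dvd_of_mem_primeFactors hp), hm⟩

theorem divisors_1806 : Nat.divisors 1806 =
    {1, 2, 3, 6, 7, 14, 21, 42, 43, 86, 129, 258, 301, 602, 903, 1806} := by
  decide +kernel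

/-- A prime `p` with `p - 1 ∣ 1806` divides `1806`. -/
theorem Nat.Prime.dvd_1806_of_sub_one_dvd {p : ℕ} (hp : p.Prime) (h : p - 1 ∣ 1806) :
    p ∣ 1806 := by
  obtain ⟨d, rfl⟩ : ∃ d, p = d + 1 := ⟨p - 1, by have := hp.pos; omega⟩
  have hd : d ∈ Nat.divisors 1806 := Nat.mem_divisors.2 ⟨h, by norm_num⟩
  simp only [divisors_1806, Finset.mem_insert, Finset.mem_singleton] at hd
  rcases hd with rfl | rfl | rfl | rfl | rfl | rfl | rfl | rfl | rfl | rfl | rfl | rfl | rfl |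
    rfl | rfl | rfl <;> first | (norm_num; done) | norm_num at hp

theorem squarefree_primeshift_set_subset
    (N : Set ℕ) (hpos : ∀ ν ∈ N, 0 < ν)
    (hsf : ∀ ν ∈ N, Squarefree ν)
    (hdvd : ∀ ν ∈ N, ∀ p : ℕ, Nat.Prime p → p ∣ ν → (p - 1) ∣ ν) :
    N ⊆ {1, 2, 6, 42, 1806} := by
  intro ν hν
  have hprime : ∀ p : ℕ, p.Prime → p ∣ ν → p ∣ 1806 := by
    intro p
    induction p using Nat.strong_induction_on with
    | _ p ih =>
      intro hp hpν
      have hsub := hdvd ν hν p hp hpν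
      refine hp.dvd_1806_of_sub_one_dvd <|
        ((hsf ν hν).squarefree_of_dvd hsub).dvd_of_forall_prime_dvd (by norm_num) fun q hq hqp => ?_
      have hle := Nat.le_of_dvd (Nat.sub_pos_of_lt hp.one_lt) hqp
      exact ih q (by have := hp.pos; omega) hq (hqp.trans hsub)
  have hmem : ν ∈ Nat.divisors 1806 :=
    Nat.mem_divisors.2 ⟨(hsf ν hν).dvd_of_forall_prime_dvd (by norm_num) hprime, by norm_num⟩
  have h3 := hdvd ν hν 3 (by norm_num)
  have h7 := hdvd ν hν 7 (by norm_num)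
  have h43 := hdvd ν hν 43 (by norm_num)
  simp only [divisors_1806, Finset.mem_insert, Finset.mem_singleton] at hmem
  simp only [Set.mem_insert_iff, Set.mem_singleton_iff]
  omega
end

section
/- For a positive integer m, the congruence S_m(m) ≡ 1 (mod m) holds if and only if m ∈ {1, 2, 6, 42, 1806}. -/
/-- The power sum `S m k = 1^m + 2^m + ⋯ + k^m`. -/
def S (m k : ℕ) : ℕ := ∑ i ∈ Finset.Icc 1 k, i ^ m

lemma ZMod.sum_range_natCast {p : ℕ} [NeZero p] {M : Type*} [AddCommMonoid M] (f : ZMod p → M) :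
    ∑ i ∈ Finset.range p, f i = ∑ x, f x := by
  refine Finset.sum_nbij' (fun i => (i : ZMod p)) ZMod.val ?_ ?_ ?_ ?_ ?_
  · simp
  · simpa using fun x => ZMod.val_lt x
  · exact fun i hi => ZMod.val_cast_of_lt (Finset.mem_range.1 hi)
  · simp
  · simp

lemma FiniteField.sum_pow_of_pos (K : Type*) [Field K] [Fintype K] {n : ℕ} (hn : 0 < n) :
    ∑ x : K, x ^ n = if Fintype.card K - 1 ∣ n then -1 else 0 := by
  classical
  rw [← FiniteField.sum_pow_units K n]
  let φ : Kˣ ↪ K := ⟨fun x ↦ x, Units.val_injective⟩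
  have h : Finset.univ.map φ = Finset.univ \ {0} := by
    ext x
    simpa only [Finset.mem_map, Finset.mem_univ, Function.Embedding.coeFn_mk, true_and,
      Finset.mem_sdiff, Finset.mem_singleton, φ] using! isUnit_iff_ne_zero
  calc
    ∑ x : K, x ^ n = ∑ x ∈ Finset.univ \ {(0 : K)}, x ^ n := by
      rw [← Finset.sum_sdiff ({0} : Finset K).subset_univ, Finset.sum_singleton,
        zero_pow hn.ne', add_zero]
    _ = ∑ x : Kˣ, (x ^ n : K) := by simp [φ, ← h, Finset.univ.sum_map φ]

lemma powerSum_mul_cast_zmod (p n k : ℕ) [NeZero p] :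
    (S n (p * k) : ZMod p) = k * ∑ x : ZMod p, x ^ n := by
  have hS (N : ℕ) : (S n N : ZMod p) = ∑ i ∈ Finset.range N, ((i : ZMod p) + 1) ^ n := by
    rw [S, Finset.range_eq_Ico, ← Finset.Ico_add_one_right_eq_Icc,
      ← Finset.sum_Ico_add' (fun i => i ^ n) 0 N 1]
    push_cast
    rfl
  rw [hS]
  induction k with
  | zero => simp
  | succ k ih =>
    rw [mul_add, mul_one, Finset.sum_range_add, ih]
    have hshift : ∑ x : ZMod p, (x + 1) ^ n = ∑ x : ZMod p, x ^ n :=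
      Equiv.sum_comp (Equiv.addRight (1 : ZMod p)) (fun x => x ^ n)
    have h := ZMod.sum_range_natCast (p := p) (fun x => (x + 1) ^ n)
    rw [hshift] at h
    simp [h, add_mul]

lemma powerSum_cast_zmod {p m : ℕ} [Fact p.Prime] (hm : 0 < m) (hp : p ∣ m) :
    (S m m : ZMod p) = (m / p : ℕ) * if p - 1 ∣ m then -1 else 0 := by
  obtain ⟨k, rfl⟩ := hp
  rw [powerSum_mul_cast_zmod, FiniteField.sum_pow_of_pos _ hm, ZMod.card,
    Nat.mul_div_cancel_left k (Fact.out : p.Prime).pos]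

lemma mem_of_dvd_1806 {d : ℕ} (h : d ∣ 1806) :
    d ∈ ({1, 2, 3, 6, 7, 14, 21, 42, 43, 86, 129, 258, 301, 602, 903, 1806} : Finset ℕ) := by
  have hd : Nat.divisors 1806 =
      {1, 2, 3, 6, 7, 14, 21, 42, 43, 86, 129, 258, 301, 602, 903, 1806} := by
    decide +kernel
  rw [← hd]
  simpa using h

lemma prime_dvd_1806_of_sub_one_dvd {m : ℕ} (hsq : Squarefree m)
    (hm : ∀ p, p.Prime → p ∣ m → p - 1 ∣ m) (p : ℕ) (hp : p.Prime) (hpm : p ∣ m) :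
    p ∣ 1806 := by
  induction p using Nat.strong_induction_on with
  | _ p ih =>
    have hd := hm p hp hpm
    have hsq' := hsq.squarefree_of_dvd hd
    have h : p - 1 ∣ 1806 := by
      rw [← Nat.prod_primeFactors_of_squarefree hsq']
      refine Finset.prod_primes_dvd _ (fun q hq => (Nat.prime_of_mem_primeFactors hq).prime) ?_
      intro q hq
      have hqp := Nat.le_of_dvd (Nat.sub_pos_of_lt hp.one_lt) (Nat.dvd_of_mem_primeFactors hq)
      exact ih q (by have := hp.pos; omega) (Nat.prime_of_mem_primeFactors hq)
        ((Nat.dvd_of_mem_primeFactors hq).trans hd)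
    obtain ⟨q, rfl⟩ : ∃ q, p = q + 1 := ⟨p - 1, by have := hp.pos; omega⟩
    have hq := mem_of_dvd_1806 h
    simp only [Finset.mem_insert, Finset.mem_singleton] at hq
    rcases hq with rfl | rfl | rfl | rfl | rfl | rfl | rfl | rfl | rfl | rfl | rfl | rfl | rfl |
      rfl | rfl | rfl <;> revert hp <;> norm_num

theorem powerSum_self_congr_one_iff (m : ℕ) (hm : 0 < m) :
    S m m ≡ 1 [MOD m] ↔ m ∈ ({1, 2, 6, 42, 1806} : Set ℕ) := by
  constructor
  · intro h
    have key (p : ℕ) (hp : p.Prime) (hpm : p ∣ m) : p - 1 ∣ m ∧ ¬ p ∣ m / p := by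
      have := Fact.mk hp
      have h1 := (ZMod.natCast_eq_natCast_iff _ _ _).2 (h.of_dvd hpm)
      rw [powerSum_cast_zmod hm hpm] at h1
      constructor
      · by_contra hd
        simp [hd] at h1
      · intro hd
        simp [(ZMod.natCast_eq_zero_iff _ _).2 hd] at h1
    have hsq : Squarefree m := by
      refine Nat.squarefree_iff_prime_squarefree.2 fun p hp hd => ?_
      exact (key p hp (dvd_of_mul_right_dvd hd)).2 (Nat.dvd_div_of_mul_dvd hd)
    have hdvd : m ∣ 1806 := by
      rw [← Nat.prod_primeFactors_of_squarefree hsq]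
      refine Finset.prod_primes_dvd _ (fun q hq => (Nat.prime_of_mem_primeFactors hq).prime) ?_
      exact fun q hq => prime_dvd_1806_of_sub_one_dvd hsq (fun p hp hpm => (key p hp hpm).1) q
        (Nat.prime_of_mem_primeFactors hq) (Nat.dvd_of_mem_primeFactors hq)
    have h3 := fun hd => (key 3 (by norm_num) hd).1
    have h7 := fun hd => (key 7 (by norm_num) hd).1
    have h43 := fun hd => (key 43 (by norm_num) hd).1
    have hm := mem_of_dvd_1806 hdvd
    clear key h hsq hdvd
    simp only [Finset.mem_insert, Finset.mem_singleton] at hm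
    rcases hm with rfl | rfl | rfl | rfl | rfl | rfl | rfl | rfl | rfl | rfl | rfl | rfl | rfl |
      rfl | rfl | rfl <;> revert h3 h7 h43 <;> norm_num
  · have two : Fact (Nat.Prime 2) := ⟨by norm_num⟩
    have three : Fact (Nat.Prime 3) := ⟨by norm_num⟩
    have seven : Fact (Nat.Prime 7) := ⟨by norm_num⟩
    have fortythree : Fact (Nat.Prime 43) := ⟨by norm_num⟩
    have key (p : ℕ) [Fact p.Prime] (hpm : p ∣ m) (hd : p - 1 ∣ m)
        (hc : p ∣ m / p + 1) : S m m ≡ 1 [MOD p] := by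
      have hc' := (ZMod.natCast_eq_zero_iff _ _).2 hc
      rw [← ZMod.natCast_eq_natCast_iff, powerSum_cast_zmod hm hpm, if_pos hd]
      push_cast at hc' ⊢
      linear_combination -hc'
    rintro (rfl | rfl | rfl | rfl | rfl)
    · exact Nat.modEq_one
    · exact key 2 (by norm_num) (by norm_num) (by norm_num)
    · have h2 := key 2 (by norm_num) (by norm_num) (by norm_num)
      have h3 := key 3 (by norm_num) (by norm_num) (by norm_num)
      unfold Nat.ModEq at *
      omega
    · have h2 := key 2 (by norm_num) (by norm_num) (by norm_num)
      have h3 := key 3 (by norm_num) (by norm_num) (by norm_num)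
      have h7 := key 7 (by norm_num) (by norm_num) (by norm_num)
      unfold Nat.ModEq at *
      omega
    · have h2 := key 2 (by norm_num) (by norm_num) (by norm_num)
      have h3 := key 3 (by norm_num) (by norm_num) (by norm_num)
      have h7 := key 7 (by norm_num) (by norm_num) (by norm_num)
      have h43 := key 43 (by norm_num) (by norm_num) (by norm_num)
      unfold Nat.ModEq at *
      omega
end

section
/- Let Q be a positive integer. If there exists a positive integer n with S_{Qn}(Qn) ≡ n (mod Qn), then Q is squarefree. -/
theorem S_eq_sum_range (m k : ℕ) : S m k = ∑ i ∈ Finset.range k, (i + 1) ^ m := by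
  rw [S, Finset.range_eq_Ico, Finset.sum_Ico_add' (fun i => i ^ m) 0 k 1]
  rfl

theorem S_mul_modEq (m a b : ℕ) : S m (a * b) ≡ b * S m a [MOD a] := by
  induction b with
  | zero => simp [S, Nat.ModEq.refl]
  | succ b ih =>
    have hblock : ∑ i ∈ Finset.range a, (a * b + i + 1) ^ m ≡ S m a [MOD a] := by
      rw [S_eq_sum_range, ← ZMod.natCast_eq_natCast_iff]
      simp
    rw [S_eq_sum_range, mul_add_one, Finset.sum_range_add, ← S_eq_sum_range, add_mul, one_mul]
    exact ih.add hblock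

theorem pow_dvd_S_pow_succ_mul (p m k t : ℕ) : p ^ k ∣ S m (p ^ (k + 1) * t) := by
  induction k generalizing t with
  | zero => simp
  | succ k ih =>
    rw [pow_succ p (k + 1), mul_assoc, (S_mul_modEq m (p ^ (k + 1)) (p * t)).dvd_iff dvd_rfl,
      pow_succ', mul_assoc]
    exact mul_dvd_mul_left p (dvd_mul_of_dvd_right (by simpa [pow_succ'] using ih 1) t)

theorem squarefree_of_exists_solution (Q : ℕ) (hQ : 0 < Q)
    (h : ∃ n : ℕ, 0 < n ∧ S (Q * n) (Q * n) ≡ n [MOD Q * n]) :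
    Squarefree Q := by
  obtain ⟨n, hn, hmod⟩ := h
  rw [Nat.squarefree_iff_prime_squarefree]
  rintro p hp ⟨q, rfl⟩
  obtain ⟨a, c, hc, rfl⟩ := Nat.exists_eq_pow_mul_and_not_dvd hn.ne' p hp.ne_one
  have hN : p * p * q * (p ^ a * c) = p ^ (a + 1 + 1) * (q * c) := by ring
  have hS : p ^ (a + 1) ∣ S (p * p * q * (p ^ a * c)) (p * p * q * (p ^ a * c)) := by
    nth_rewrite 2 [hN]
    exact pow_dvd_S_pow_succ_mul _ _ _ _
  have hdvd : p ^ (a + 1) ∣ p * p * q * (p ^ a * c) := ⟨p * (q * c), by ring⟩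
  have hn_dvd := (hmod.dvd_iff hdvd).mp hS
  rw [pow_succ] at hn_dvd
  exact hc (Nat.dvd_of_mul_dvd_mul_left (pow_pos hp.pos a) hn_dvd)
end

section
/- Let Q and n be positive integers such that n is even and S_{Qn}(Qn) ≡ n (mod Qn). Then Q is even. -/
theorem sum_Icc_mod_two (k : ℕ) : ∑ i ∈ Finset.Icc 1 (2 * k), i % 2 = k := by
  induction k with
  | zero => simp
  | succ k ih =>
    rw [show 2 * (k + 1) = 2 * k + 1 + 1 by ring, Finset.sum_Icc_succ_top (by omega),
      Finset.sum_Icc_succ_top (by omega), ih]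
    omega

/-- If `2 ^ (b + 1)` divides `N > 0`, then `N`-th powers are `0` or `1` modulo `2 ^ (b + 1)`,
according to parity. -/
theorem pow_modEq_mod_two {N b : ℕ} (hN : 0 < N) (h : 2 ^ (b + 1) ∣ N) (i : ℕ) :
    i ^ N ≡ i % 2 [MOD 2 ^ (b + 1)] := by
  rcases Nat.even_or_odd i with hi | hi
  · rw [Nat.even_iff.mp hi]
    refine (Nat.modEq_zero_iff_dvd).mpr ?_
    have hle : b + 1 ≤ N := (Nat.lt_two_pow_self).le.trans (Nat.le_of_dvd hN h)
    exact (pow_dvd_pow 2 hle).trans (pow_dvd_pow_of_dvd hi.two_dvd N)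
  · rw [Nat.odd_iff.mp hi]
    have hcop : Nat.Coprime i (2 ^ (b + 1)) := (Nat.coprime_two_right.mpr hi).pow_right _
    obtain ⟨c, rfl⟩ := h
    have htot := Nat.ModEq.pow_totient hcop
    rw [Nat.totient_prime_pow_succ Nat.prime_two] at htot
    have hpow := htot.pow (2 * c)
    rw [one_pow, ← pow_mul] at hpow
    convert hpow using 2
    ring

theorem S_modEq_of_two_pow_dvd {k b : ℕ} (hk : 0 < k) (h : 2 ^ (b + 1) ∣ 2 * k) :
    S (2 * k) (2 * k) ≡ k [MOD 2 ^ (b + 1)] := by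
  have hsum : S (2 * k) (2 * k) ≡ ∑ i ∈ Finset.Icc 1 (2 * k), i % 2 [MOD 2 ^ (b + 1)] :=
    Nat.ModEq.sum fun i _ => pow_modEq_mod_two (by omega) h i
  rwa [sum_Icc_mod_two] at hsum

theorem even_Q_of_even_solution (Q n : ℕ) (hQ : 0 < Q) (hn : 0 < n)
    (hev : Even n) (h : S (Q * n) (Q * n) ≡ n [MOD Q * n]) :
    Even Q := by
  by_contra hodd
  rw [Nat.not_even_iff_odd] at hodd
  obtain ⟨a, m, hm, rfl⟩ := Nat.exists_eq_two_pow_mul_odd hn.ne'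
  obtain _ | b := a
  · simp only [pow_zero, one_mul] at hev
    exact (Nat.not_even_iff_odd.mpr hm) hev
  have hN : Q * (2 ^ (b + 1) * m) = 2 * (2 ^ b * (Q * m)) := by ring
  have hdvd : 2 ^ (b + 1) ∣ Q * (2 ^ (b + 1) * m) := ⟨Q * m, by ring⟩
  have hmod := h.of_dvd hdvd
  rw [hN] at hmod hdvd
  have hm0 : 0 < m := hm.pos
  have hhalf := S_modEq_of_two_pow_dvd (by positivity) hdvd
  have hzero : 2 ^ b * (Q * m) ≡ 0 [MOD 2 ^ (b + 1)] :=
    (hhalf.symm.trans hmod).trans ((Nat.modEq_zero_iff_dvd).mpr (dvd_mul_right _ _))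
  rw [Nat.modEq_zero_iff_dvd, pow_succ] at hzero
  have htwo : 2 ∣ Q * m := Nat.dvd_of_mul_dvd_mul_left (by positivity) hzero
  exact Nat.not_even_iff_odd.mpr (hodd.mul hm) (even_iff_two_dvd.mpr htwo)
end

section
/- Let Q and n be positive integers. Then S_{Qn}(Qn) ≡ n (mod Qn) holds if and only if the following two conditions both hold: (i) for every prime p dividing Q, p-1 divides Qn and Q/p + 1 ≡ 0 (mod p); (ii) for every prime p dividing n but not dividing Q, p-1 does not divide Qn. -/
lemma sum_range_mul_zmod {R : Type*} [AddCommMonoid R] (c M : ℕ) (f : ZMod c → R) :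
    ∑ i ∈ Finset.range (c * M), f (i : ZMod c) = M • ∑ i ∈ Finset.range c, f (i : ZMod c) := by
  induction M with
  | zero => simp
  | succ M ih =>
    rw [Nat.mul_succ, Finset.sum_range_add, ih, succ_nsmul]
    simp

lemma sum_range_eq_sum_zmod {R : Type*} [AddCommMonoid R] (c : ℕ) [NeZero c] (f : ZMod c → R) :
    ∑ i ∈ Finset.range c, f (i : ZMod c) = ∑ x : ZMod c, f x := by
  refine Finset.sum_bij' (fun i _ => (i : ZMod c)) (fun x _ => x.val) ?_ ?_ ?_ ?_ ?_
  · simp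
  · intro x _
    simpa using ZMod.val_lt x
  · intro i hi
    simpa using Nat.mod_eq_of_lt (Finset.mem_range.1 hi)
  · simp
  · simp

lemma cast_S_self (c M : ℕ) (h : c * M ≠ 0) :
    (S (c * M) (c * M) : ZMod c) =
      M * ∑ i ∈ Finset.range c, (i : ZMod c) ^ (c * M) := by
  have h1 : S (c * M) (c * M) = ∑ i ∈ Finset.range (c * M + 1), i ^ (c * M) := by
    unfold S
    rw [Finset.range_eq_Ico, Finset.sum_eq_sum_Ico_succ_bot (by omega), zero_pow h, zero_add]
    rfl
  rw [h1, Finset.sum_range_succ, Nat.cast_add, Nat.cast_sum]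
  have h2 := sum_range_mul_zmod c M (fun x => x ^ (c * M))
  simp only [Nat.cast_pow]
  rw [h2, nsmul_eq_mul]
  simp [h]

lemma sum_range_pow_of_sub_one_dvd {p k N : ℕ} (hp : p.Prime) (hk : 0 < k) (hN : N ≠ 0)
    (hpk : p ^ k ∣ N) (h : p - 1 ∣ N) :
    ∑ i ∈ Finset.range (p ^ k), (i : ZMod (p ^ k)) ^ N = (Nat.totient (p ^ k) : ZMod (p ^ k)) := by
  have hkN : k ≤ N := (Nat.lt_pow_self hp.one_lt).le.trans (Nat.le_of_dvd (by omega) hpk)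
  have hdvd : Nat.totient (p ^ k) ∣ N := by
    rw [Nat.totient_prime_pow hp hk]
    refine Nat.Coprime.mul_dvd_of_dvd_of_dvd ?_ ((pow_dvd_pow p (by omega)).trans hpk) h
    exact Nat.Coprime.pow_left _
      ((Nat.coprime_self_sub_right hp.one_le).2 (Nat.coprime_one_right p))
  rw [Nat.totient, ← Finset.sum_boole]
  refine Finset.sum_congr rfl fun i _ => ?_
  split_ifs with hi
  · obtain ⟨t, rfl⟩ := hdvd
    have h1 := congrArg Units.val (ZMod.pow_totient (ZMod.unitOfCoprime i hi.symm))
    simp only [Units.val_pow_eq_pow_val, ZMod.coe_unitOfCoprime, Units.val_one] at h1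
    rw [pow_mul, h1, one_pow]
  · have hpi : p ∣ i := by
      by_contra hpi
      exact hi (Nat.Coprime.pow_left _ ((Nat.Prime.coprime_iff_not_dvd hp).2 hpi))
    rw [← Nat.cast_pow, ZMod.natCast_eq_zero_iff]
    exact (pow_dvd_pow p hkN).trans (pow_dvd_pow_of_dvd hpi N)

lemma sum_range_pow_of_not_sub_one_dvd {p k N : ℕ} (hp : p.Prime) (h : ¬ p - 1 ∣ N) :
    ∑ i ∈ Finset.range (p ^ k), (i : ZMod (p ^ k)) ^ N = 0 := by
  have := Fact.mk hp
  have : NeZero (p ^ k) := ⟨pow_ne_zero _ hp.ne_zero⟩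
  obtain ⟨u, hu⟩ : ∃ u : (ZMod p)ˣ, u ^ N ≠ 1 := by
    by_contra! hall
    have := (FiniteField.forall_pow_eq_one_iff (ZMod p) N).1 hall
    rw [ZMod.card] at this
    exact h this
  set g : ℕ := (u : ZMod p).val with hg
  have hgu : (g : ZMod p) = u := by simp [hg]
  have hgp : g.Coprime p := ZMod.val_coe_unit_coprime u
  have hcop : IsCoprime ((p ^ k : ℕ) : ℤ) ((g : ℤ) ^ N - 1) := by
    rw [Nat.cast_pow]
    refine IsCoprime.pow_left ?_
    refine (Prime.coprime_iff_not_dvd (Nat.prime_iff_prime_int.1 hp)).2 fun hd => hu ?_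
    have := (ZMod.intCast_zmod_eq_zero_iff_dvd _ p).2 hd
    push_cast at this
    rw [hgu, sub_eq_zero] at this
    exact Units.ext (by simpa using this)
  have hsum : ((g : ZMod (p ^ k)) ^ N - 1) *
      ∑ i ∈ Finset.range (p ^ k), (i : ZMod (p ^ k)) ^ N = 0 := by
    rw [sum_range_eq_sum_zmod (p ^ k) (fun x => x ^ N), sub_mul, one_mul, sub_eq_zero,
      Finset.mul_sum]
    let v := ZMod.unitOfCoprime g (Nat.Coprime.pow_right k hgp)
    rw [← Equiv.sum_comp (Units.mulLeft v) (fun x : ZMod (p ^ k) => x ^ N)]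
    simp [v, mul_pow]
  have hd : ((p ^ k : ℕ) : ℤ) ∣ ((g : ℤ) ^ N - 1) *
      ∑ i ∈ Finset.range (p ^ k), (i : ℤ) ^ N := by
    rw [← ZMod.intCast_zmod_eq_zero_iff_dvd]
    push_cast
    simpa using hsum
  have := (ZMod.intCast_zmod_eq_zero_iff_dvd _ (p ^ k)).2 (hcop.dvd_of_dvd_mul_left hd)
  push_cast at this
  simpa using this

lemma cast_S_self_of_not_sub_one_dvd {p k N : ℕ} (hp : p.Prime) (hN : N ≠ 0)
    (hpk : p ^ k ∣ N) (h : ¬ p - 1 ∣ N) : (S N N : ZMod (p ^ k)) = 0 := by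
  obtain ⟨M, rfl⟩ := hpk
  rw [cast_S_self _ _ hN, sum_range_pow_of_not_sub_one_dvd hp h, mul_zero]

lemma cast_S_self_of_sub_one_dvd {p k N : ℕ} (hp : p.Prime) (hk : 0 < k) (hN : N ≠ 0)
    (hpk : p ^ k ∣ N) (h : p - 1 ∣ N) :
    (S N N : ZMod (p ^ k)) = -((N / p : ℕ) : ZMod (p ^ k)) := by
  obtain ⟨M, rfl⟩ := hpk
  rw [cast_S_self _ _ hN, sum_range_pow_of_sub_one_dvd hp hk hN (dvd_mul_right _ _) h,
    eq_neg_iff_add_eq_zero, ← Nat.cast_mul, ← Nat.cast_add, ZMod.natCast_eq_zero_iff]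
  obtain ⟨j, rfl⟩ : ∃ j, k = j + 1 := ⟨k - 1, by omega⟩
  obtain ⟨q, rfl⟩ : ∃ q, p = q + 1 := ⟨p - 1, by have := hp.pos; omega⟩
  have hdiv : (q + 1) ^ (j + 1) * M / (q + 1) = (q + 1) ^ j * M := by
    rw [pow_succ, mul_right_comm]
    exact Nat.mul_div_cancel _ (by omega)
  rw [Nat.totient_prime_pow_succ hp, hdiv]
  exact ⟨M, by simp only [Nat.add_sub_cancel]; ring⟩

lemma modEq_iff_forall_prime (N a b : ℕ) (hN : N ≠ 0) :
    a ≡ b [MOD N] ↔ ∀ p, p.Prime → p ∣ N → a ≡ b [MOD p ^ N.factorization p] := by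
  refine ⟨fun h p _ _ => h.of_dvd (Nat.ordProj_dvd N p), fun h => ?_⟩
  rw [Nat.modEq_iff_dvd, ← Int.dvd_natAbs, Int.natCast_dvd_natCast,
    Nat.dvd_iff_prime_pow_dvd_dvd]
  intro p k hp hk
  rcases Nat.eq_zero_or_pos k with rfl | hk0
  · simp
  have h1 := h p hp ((dvd_pow_self p hk0.ne').trans hk)
  rw [Nat.modEq_iff_dvd, ← Int.dvd_natAbs, Int.natCast_dvd_natCast] at h1
  exact (pow_dvd_pow p ((hp.pow_dvd_iff_le_factorization hN).1 hk)).trans h1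

/-- The congruence at a prime `p` dividing `Q * n`. -/
lemma S_modEq_prime_pow_iff {p Q n : ℕ} (hp : p.Prime) (hQ : Q ≠ 0) (hn : n ≠ 0)
    (hpN : p ∣ Q * n) :
    S (Q * n) (Q * n) ≡ n [MOD p ^ (Q * n).factorization p] ↔
      (p ∣ Q → p - 1 ∣ Q * n ∧ ¬ p ^ 2 ∣ Q ∧ Q / p + 1 ≡ 0 [MOD p]) ∧
        (¬ p ∣ Q → ¬ p - 1 ∣ Q * n) := by
  have hN : Q * n ≠ 0 := mul_ne_zero hQ hn
  have hfac : (Q * n).factorization p = n.factorization p + Q.factorization p := by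
    rw [Nat.factorization_mul hQ hn, Finsupp.add_apply, add_comm]
  have hk : 0 < (Q * n).factorization p := hp.factorization_pos_of_dvd hN hpN
  have hdvd := Nat.ordProj_dvd (Q * n) p
  have hpos : 0 < p := hp.pos
  rw [← ZMod.natCast_eq_natCast_iff]
  by_cases h : p - 1 ∣ Q * n
  · rw [cast_S_self_of_sub_one_dvd hp hk hN hdvd h, eq_comm, eq_neg_iff_add_eq_zero,
      ← Nat.cast_add, ZMod.natCast_eq_zero_iff]
    by_cases hpQ : p ∣ Q
    · obtain ⟨q, rfl⟩ := hpQ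
      have hq : q ≠ 0 := right_ne_zero_of_mul hQ
      have e1 : p * q * n / p = q * n := by
        rw [mul_assoc, Nat.mul_div_cancel_left _ hpos]
      have e2 : n + q * n = n * (q + 1) := by ring
      have e3 : p * q / p = q := Nat.mul_div_cancel_left _ hpos
      have e4 : (p * q).factorization p = q.factorization p + 1 := by
        rw [Nat.factorization_mul hp.ne_zero hq, Finsupp.add_apply, hp.factorization_self, add_comm]
      have e5 : p ^ 2 ∣ p * q ↔ p ∣ q := by
        rw [pow_two, Nat.mul_dvd_mul_iff_left hpos]
      rw [e1, e2, e3, e5, hp.pow_dvd_iff_le_factorization (by positivity),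
        Nat.factorization_mul hn (by omega), hfac, e4, Finsupp.add_apply, Nat.add_le_add_iff_left,
        ← hp.pow_dvd_iff_le_factorization (by omega), Nat.modEq_zero_iff_dvd]
      simp only [h, dvd_mul_right, true_and, true_imp_iff, not_true, false_imp_iff, and_true]
      constructor
      · intro hd
        have hd1 : p ∣ q + 1 := (dvd_pow_self p (Nat.succ_ne_zero _)).trans hd
        exact ⟨fun hpq => hp.one_lt.ne' (Nat.dvd_one.1 ((Nat.dvd_add_right hpq).1 hd1)), hd1⟩
      · rintro ⟨hpq, hd⟩
        rwa [Nat.factorization_eq_zero_of_not_dvd hpq, zero_add, pow_one]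
    · simp only [h, hpQ, not_true, not_false_eq_true, true_imp_iff, and_false, iff_false]
      rw [Nat.factorization_eq_zero_of_not_dvd hpQ, add_zero] at hfac
      intro hd
      rw [Nat.dvd_add_right (hfac ▸ Nat.ordProj_dvd n p),
        hp.pow_dvd_iff_le_factorization
          (Nat.div_pos (Nat.le_of_dvd (Nat.pos_of_ne_zero hN) hpN) hpos).ne',
        Nat.factorization_div hpN, Finsupp.tsub_apply, hp.factorization_self] at hd
      omega
  · rw [cast_S_self_of_not_sub_one_dvd hp hN hdvd h, eq_comm, ZMod.natCast_eq_zero_iff,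
      hp.pow_dvd_iff_le_factorization hn, hfac]
    by_cases hpQ : p ∣ Q
    · have := hp.factorization_pos_of_dvd hQ hpQ
      simp only [h, hpQ, false_and, true_imp_iff, iff_false]
      omega
    · simp [h, hpQ, Nat.factorization_eq_zero_of_not_dvd hpQ]

theorem solution_iff (Q n : ℕ) (hQ : 0 < Q) (hn : 0 < n) :
    S (Q * n) (Q * n) ≡ n [MOD Q * n] ↔
      ((∀ p : ℕ, Nat.Prime p → p ∣ Q →
          (p - 1) ∣ Q * n ∧ ¬ p ^ 2 ∣ Q ∧ Q / p + 1 ≡ 0 [MOD p]) ∧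
       (∀ p : ℕ, Nat.Prime p → p ∣ n → ¬ p ∣ Q → ¬ (p - 1) ∣ Q * n)) := by
  rw [modEq_iff_forall_prime _ _ _ (mul_pos hQ hn).ne']
  constructor
  · intro h
    exact ⟨fun p hp hpQ => ((S_modEq_prime_pow_iff hp hQ.ne' hn.ne' (hpQ.mul_right n)).1
        (h p hp (hpQ.mul_right n))).1 hpQ,
      fun p hp hpn => ((S_modEq_prime_pow_iff hp hQ.ne' hn.ne' (hpn.mul_left Q)).1
        (h p hp (hpn.mul_left Q))).2⟩
  · rintro ⟨h1, h2⟩ p hp hpN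
    exact (S_modEq_prime_pow_iff hp hQ.ne' hn.ne' hpN).2
      ⟨h1 p hp, fun hpQ => h2 p hp ((hp.dvd_mul.1 hpN).resolve_left hpQ) hpQ⟩
end

section
/- Let Q be a positive integer. If there exists a positive integer n with S_{Qn}(Qn) ≡ n (mod Qn), then Q is a weak primary pseudoperfect number, i.e., Q is squarefree and ∑_{p | Q, p prime} Q/p + 1 ≡ 0 (mod Q). -/
/-- If `i ↦ i ^ m` is `K`-periodic modulo `D`, the sum over `b` periods is `b` times the sum over
one period. -/
lemma sum_range_mul_pow_modEq {m K : ℕ} {D : ℤ}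
    (h : ∀ a j : ℕ, ((a + j * K : ℕ) : ℤ) ^ m ≡ (a : ℤ) ^ m [ZMOD D]) (b : ℕ) :
    ∑ i ∈ Finset.range (b * K), (i : ℤ) ^ m ≡ b * ∑ i ∈ Finset.range K, (i : ℤ) ^ m [ZMOD D] := by
  induction b with
  | zero => simp
  | succ b ih =>
    rw [add_mul, one_mul, Finset.sum_range_add]
    push_cast
    rw [add_mul, one_mul]
    refine ih.add (Int.ModEq.sum fun i _ => ?_)
    have := h i b
    push_cast at this
    rwa [add_comm] at this

lemma add_pow_modEq_of_dvd {p m k : ℕ} (hp : p.Prime) (hm : p ∣ m) (a : ℤ) {y : ℤ}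
    (hy : (p : ℤ) ^ (k + 1) ∣ y) : (a + y) ^ m ≡ a ^ m [ZMOD (p : ℤ) ^ (k + 2)] := by
  obtain ⟨m, rfl⟩ := hm
  rw [pow_mul, pow_mul]
  refine Int.ModEq.pow _ ?_
  obtain ⟨z, hz⟩ := exists_add_pow_prime_eq hp a y
  obtain ⟨w, rfl⟩ := hy
  refine (Int.modEq_iff_dvd.2 ?_).symm
  have h1 : (p : ℤ) ^ (k + 2) ∣ ((p : ℤ) ^ (k + 1) * w) ^ p := by
    refine dvd_trans ?_ (pow_dvd_pow _ hp.two_le)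
    exact ⟨(p : ℤ) ^ k * w ^ 2, by ring⟩
  obtain ⟨v, hv⟩ := h1
  exact ⟨v + a * w * z, by rw [hz, hv]; ring⟩

lemma sum_range_prime_pow_mul_modEq {p m : ℕ} (hp : p.Prime) (hm : p ∣ m) (c k : ℕ) :
    ∑ i ∈ Finset.range (p ^ (k + 1) * c), (i : ℤ) ^ m ≡
      p ^ k * c * ∑ i ∈ Finset.range p, (i : ℤ) ^ m [ZMOD (p : ℤ) ^ (k + 1)] := by
  induction k with
  | zero =>
    rw [mul_comm, zero_add, pow_one, pow_zero, one_mul, pow_one]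
    refine sum_range_mul_pow_modEq (fun a j => Int.ModEq.pow _ ?_) c
    push_cast
    exact (Int.modEq_iff_dvd.2 ⟨j, by ring⟩).symm
  | succ k ih =>
    have h1 : p ^ (k + 1 + 1) * c = p * (p ^ (k + 1) * c) := by ring
    rw [h1]
    refine (sum_range_mul_pow_modEq (fun a j => ?_) p).trans ?_
    · push_cast
      exact add_pow_modEq_of_dvd hp hm _ ⟨j * c, by ring⟩
    · have h2 := ih.mul_left' (c := (p : ℤ))
      rw [← pow_succ'] at h2
      convert h2 using 1
      ring

lemma prime_dvd_sum_range_pow_or_dvd_add_one {p m : ℕ} (hp : p.Prime) (hm : m ≠ 0) :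
    (p : ℤ) ∣ ∑ i ∈ Finset.range p, (i : ℤ) ^ m ∨
      (p : ℤ) ∣ ∑ i ∈ Finset.range p, (i : ℤ) ^ m + 1 := by
  have := Fact.mk hp
  have h1 : ((∑ i ∈ Finset.range p, (i : ℤ) ^ m : ℤ) : ZMod p) =
      ∑ x : (ZMod p)ˣ, (x ^ m : ZMod p) := by
    have h2 : ∑ x : (ZMod p)ˣ, (x ^ m : ZMod p) = ∑ x : ZMod p, x ^ m := by
      rw [← Fintype.sum_subtype_add_sum_subtype (fun x : ZMod p => x ≠ 0)]
      rw [Finset.sum_eq_zero (s := (Finset.univ : Finset {x : ZMod p // ¬ x ≠ 0})), add_zero]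
      · exact Fintype.sum_equiv unitsEquivNeZero _ _ fun x => rfl
      · rintro ⟨x, hx⟩ -
        simp only [not_not] at hx
        simp [hx, hm]
    rw [h2]
    push_cast
    refine Finset.sum_bij (fun i _ => (i : ZMod p)) (by simp) ?_ ?_ (by simp)
    · intro a ha b hb hab
      rw [Finset.mem_range] at ha hb
      have := (ZMod.natCast_eq_natCast_iff' a b p).1 hab
      rwa [Nat.mod_eq_of_lt ha, Nat.mod_eq_of_lt hb] at this
    · intro b _
      exact ⟨b.val, Finset.mem_range.2 b.val_lt, by simp⟩
  rw [← ZMod.intCast_zmod_eq_zero_iff_dvd, ← ZMod.intCast_zmod_eq_zero_iff_dvd]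
  rw [Int.cast_add, h1, FiniteField.sum_pow_units]
  split_ifs <;> simp

lemma S_modEq_sum_range {m : ℕ} (hm : m ≠ 0) (K : ℕ) :
    (S m K : ℤ) ≡ ∑ i ∈ Finset.range K, (i : ℤ) ^ m [ZMOD K] := by
  have h : (S m K : ℤ) = ∑ i ∈ Finset.range K, (i : ℤ) ^ m + (K : ℤ) ^ m := by
    rw [← Finset.sum_range_succ, Finset.sum_range_succ', S, ← Finset.Ico_add_one_right_eq_Icc,
      Finset.sum_Ico_eq_sum_range]
    simp [hm, add_comm]
  rw [h]
  refine (Int.modEq_iff_dvd.2 ?_).symm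
  rw [add_sub_cancel_left]
  exact dvd_pow_self _ hm

lemma not_sq_dvd_and_dvd_div_add_one {Q n p : ℕ} (hQ : 0 < Q) (hn : 0 < n)
    (h : S (Q * n) (Q * n) ≡ n [MOD Q * n]) (hp : p.Prime) (hpQ : p ∣ Q) :
    ¬ p * p ∣ Q ∧ p ∣ Q / p + 1 := by
  obtain ⟨q, rfl⟩ := hpQ
  have hp0 : (p : ℤ) ≠ 0 := by exact_mod_cast hp.ne_zero
  have hpI : Prime (p : ℤ) := Nat.prime_iff_prime_int.1 hp
  have hN : p * q * n ≠ 0 := by positivity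
  have hqn : q * n ≠ 0 := fun h0 => hN (by rw [mul_assoc, h0, mul_zero])
  obtain ⟨k, c, hc, hkc⟩ := Nat.exists_eq_pow_mul_and_not_dvd hqn p hp.ne_one
  have hcI : ¬ (p : ℤ) ∣ c := by exact_mod_cast hc
  have hNk : p * q * n = p ^ (k + 1) * c := by rw [mul_assoc, hkc]; ring
  have hkcI : (q : ℤ) * n = p ^ k * c := by exact_mod_cast hkc
  have hdvd : (p : ℤ) ^ (k + 1) ∣ ((p * q * n : ℕ) : ℤ) := ⟨c, by rw [hNk]; push_cast; ring⟩
  have h1 := (Int.natCast_modEq_iff.2 h).symm.trans (S_modEq_sum_range hN _)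
  have h2 := h1.of_dvd hdvd
  have h3 := sum_range_prime_pow_mul_modEq hp (m := p * q * n) ⟨q * n, by ring⟩ c k
  rw [← hNk] at h3
  have h4 := (h2.trans h3).symm.dvd
  rcases prime_dvd_sum_range_pow_or_dvd_add_one hp hN with ⟨t, ht⟩ | ⟨t, ht⟩
  · rw [ht] at h4
    have h5 : (p : ℤ) ^ (k + 1) ∣ n :=
      (dvd_sub_left ⟨c * t, by ring⟩).1 h4
    obtain ⟨r, hr⟩ := h5
    refine absurd ⟨q * r, ?_⟩ hcI
    have h6 : (p : ℤ) ^ k * c = p ^ k * (p * (q * r)) := by rw [← hkcI, hr]; ring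
    exact mul_left_cancel₀ (pow_ne_zero _ hp0) h6
  · obtain ⟨u, hu⟩ := h4
    have ht' := eq_sub_of_add_eq ht
    rw [ht'] at hu
    have hr : (n : ℤ) = p ^ k * (p * u + p * c * t - c) := by linear_combination hu
    set r : ℤ := p * u + p * c * t - c with hrdef
    have hpr : ¬ (p : ℤ) ∣ r := fun hd => hcI <| by
      have : (c : ℤ) = p * (u + c * t) - r := by rw [hrdef]; ring
      rw [this]
      exact dvd_sub (dvd_mul_right _ _) hd
    have hqr : (q : ℤ) * r = c := by
      refine mul_left_cancel₀ (pow_ne_zero k hp0) ?_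
      rw [← hkcI, hr]; ring
    constructor
    · intro hd
      have hq : p ∣ q := Nat.dvd_of_mul_dvd_mul_left hp.pos hd
      exact hcI (hqr ▸ (Int.natCast_dvd_natCast.2 hq).mul_right r)
    · rw [Nat.mul_div_cancel_left _ hp.pos, ← Int.natCast_dvd_natCast]
      refine (hpI.dvd_or_dvd (b := r) ⟨u + c * t, ?_⟩).resolve_right hpr
      push_cast
      rw [add_mul, hqr, hrdef]
      ring

theorem weakPPN_of_exists_solution (Q : ℕ) (hQ : 0 < Q)
    (h : ∃ n : ℕ, 0 < n ∧ S (Q * n) (Q * n) ≡ n [MOD Q * n]) :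
    Squarefree Q ∧ (∑ p ∈ Q.primeFactors, Q / p) + 1 ≡ 0 [MOD Q] := by
  obtain ⟨n, hn, h⟩ := h
  have key := fun (p : ℕ) (hp : p.Prime) => not_sq_dvd_and_dvd_div_add_one hQ hn h hp
  have hsq : Squarefree Q := Nat.squarefree_iff_prime_squarefree.2 fun p hp hd =>
    (key p hp (dvd_of_mul_left_dvd hd)).1 hd
  refine ⟨hsq, (Nat.modEq_zero_iff_dvd).2 ?_⟩
  rw [← Nat.prod_primeFactors_of_squarefree hsq]
  refine Finset.prod_primes_dvd _ (fun p hp => (Nat.prime_of_mem_primeFactors hp).prime) ?_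
  intro p hp
  rw [Nat.prod_primeFactors_of_squarefree hsq, ← Finset.add_sum_erase _ _ hp, add_right_comm]
  have hpp := Nat.prime_of_mem_primeFactors hp
  refine dvd_add (key p hpp (Nat.dvd_of_mem_primeFactors hp)).2 (Finset.dvd_sum fun q hq => ?_)
  obtain ⟨hqp, hq⟩ := Finset.mem_erase.1 hq
  have hqq := Nat.prime_of_mem_primeFactors hq
  obtain ⟨d, hd⟩ := Nat.dvd_of_mem_primeFactors hq
  rw [hd, Nat.mul_div_cancel_left _ hqq.pos]
  have hpd : p ∣ q * d := hd ▸ Nat.dvd_of_mem_primeFactors hp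
  exact ((Nat.coprime_primes hpp hqq).2 hqp.symm).dvd_of_dvd_mul_left hpd
end

section
/- For Q = 47058 and for Q = 2214502422, the set 𝔑_Q is non-empty; moreover, in both cases 5 is the minimum element of 𝔑_Q, i.e., S_{5Q}(5Q) ≡ 5 (mod 5Q) and no positive integer n < 5 satisfies S_{Qn}(Qn) ≡ n (mod Qn). -/
/-- The set `𝔑_Q` of positive integers `n` with `S_{Qn}(Qn) ≡ n (mod Qn)`. -/
def Nset (Q : ℕ) : Set ℕ := {n | 0 < n ∧ S (Q * n) (Q * n) ≡ n [MOD Q * n]}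

theorem sum_range_natCast_zmod {M : Type*} [AddCommMonoid M] (p : ℕ) [NeZero p]
    (f : ZMod p → M) : ∑ i ∈ Finset.range p, f i = ∑ x : ZMod p, f x := by
  refine Finset.sum_bij' (fun i _ => (i : ZMod p)) (fun x _ => x.val) ?_ ?_ ?_ ?_ ?_
  · simp
  · intro x _
    exact Finset.mem_range.2 (ZMod.val_lt x)
  · intro i hi
    exact ZMod.val_cast_of_lt (Finset.mem_range.1 hi)
  · simp
  · simp

theorem sum_zmod_pow (p m : ℕ) [Fact p.Prime] (hm : m ≠ 0) :
    ∑ x : ZMod p, x ^ m = if p - 1 ∣ m then -1 else 0 := by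
  classical
  have h := FiniteField.sum_pow_units (ZMod p) m
  rw [ZMod.card] at h
  rw [← h, ← Fintype.sum_subtype_add_sum_subtype (fun x : ZMod p => x ≠ 0)]
  have h0 : ∑ x : {x : ZMod p // ¬ x ≠ 0}, (x : ZMod p) ^ m = 0 :=
    Finset.sum_eq_zero fun x _ => by rw [not_not.1 x.2, zero_pow hm]
  rw [h0, add_zero]
  exact (Fintype.sum_equiv unitsEquivNeZero _ _ fun x => by simp).symm

/-- The power sum over `k` full residue systems modulo a prime. -/
theorem natCast_S_prime_mul (p m k : ℕ) [Fact p.Prime] (hm : m ≠ 0) :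
    (S m (p * k) : ZMod p) = k * if p - 1 ∣ m then -1 else 0 := by
  rw [S_eq_sum_range, ← sum_zmod_pow p m hm]
  push_cast
  induction k with
  | zero => simp
  | succ k ih =>
    rw [Nat.mul_succ, Finset.sum_range_add, ih, Nat.cast_succ, add_mul, one_mul]
    congr 1
    rw [← Equiv.sum_comp (Equiv.addRight (1 : ZMod p)), ← sum_range_natCast_zmod]
    simp

theorem S_self_modEq {p M n k : ℕ} (hp : p.Prime) (hM : M = p * k) (hM0 : M ≠ 0)
    (hd : p - 1 ∣ M) (hk : p ∣ k + n) : S M M ≡ n [MOD p] := by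
  have := Fact.mk hp
  rw [← ZMod.natCast_eq_natCast_iff]
  have h := natCast_S_prime_mul p M k hM0
  rw [← hM, if_pos hd] at h
  have hk' := (ZMod.natCast_eq_zero_iff (k + n) p).2 hk
  push_cast at hk'
  rw [h]
  linear_combination -hk'

theorem S_self_modEq_zero {p M k : ℕ} (hp : p.Prime) (hM : M = p * k) (hM0 : M ≠ 0)
    (hd : ¬ p - 1 ∣ M) : S M M ≡ 0 [MOD p] := by
  have := Fact.mk hp
  rw [← ZMod.natCast_eq_natCast_iff]
  have h := natCast_S_prime_mul p M k hM0
  rw [← hM, if_neg hd] at h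
  simpa using h

theorem five_le_of_mem_Nset {Q n : ℕ} (hQ : Q ≠ 0) (h11 : 11 ∣ Q) (h5 : ¬ 5 ∣ Q)
    (hn : n ∈ Nset Q) : 5 ≤ n := by
  obtain ⟨h0, h⟩ := hn
  by_contra! hlt
  have hdvd : 11 ∣ Q * n := h11.mul_right n
  obtain ⟨k, hk⟩ := hdvd
  have hz : S (Q * n) (Q * n) ≡ 0 [MOD 11] := by
    refine S_self_modEq_zero (by norm_num) hk (by positivity) fun hd => ?_
    have h5' : 5 ∣ Q * n := dvd_trans (by norm_num) hd
    rcases (Nat.Prime.dvd_mul (by norm_num)).1 h5' with h' | h'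
    · exact h5 h'
    · omega
  have := ((h.of_dvd ⟨k, hk⟩).symm.trans hz)
  simp only [Nat.ModEq] at this
  omega

theorem five_mem_Nset_47058 : 5 ∈ Nset 47058 := by
  refine ⟨by norm_num, ?_⟩
  obtain ⟨M, hM⟩ : ∃ M, M = 47058 * 5 := ⟨_, rfl⟩
  rw [← hM]
  have h2 : S M M ≡ 5 [MOD 2] :=
    S_self_modEq (k := 117645) (by norm_num) (by omega) (by omega) (by norm_num [hM]) (by norm_num)
  have h3 : S M M ≡ 5 [MOD 3] :=
    S_self_modEq (k := 78430) (by norm_num) (by omega) (by omega) (by norm_num [hM]) (by norm_num)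
  have h5 : S M M ≡ 5 [MOD 5] :=
    S_self_modEq_zero (k := 47058) (by norm_num) (by omega) (by omega) (by norm_num [hM])
  have h11 : S M M ≡ 5 [MOD 11] :=
    S_self_modEq (k := 21390) (by norm_num) (by omega) (by omega) (by norm_num [hM]) (by norm_num)
  have h23 : S M M ≡ 5 [MOD 23] :=
    S_self_modEq (k := 10230) (by norm_num) (by omega) (by omega) (by norm_num [hM]) (by norm_num)
  have h31 : S M M ≡ 5 [MOD 31] :=
    S_self_modEq (k := 7590) (by norm_num) (by omega) (by omega) (by norm_num [hM]) (by norm_num)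
  have h := (Nat.modEq_and_modEq_iff_modEq_mul (by norm_num)).1 ⟨h2, h3⟩
  replace h := (Nat.modEq_and_modEq_iff_modEq_mul (by norm_num)).1 ⟨h, h11⟩
  replace h := (Nat.modEq_and_modEq_iff_modEq_mul (by norm_num)).1 ⟨h, h23⟩
  replace h := (Nat.modEq_and_modEq_iff_modEq_mul (by norm_num)).1 ⟨h, h31⟩
  replace h := (Nat.modEq_and_modEq_iff_modEq_mul (by norm_num)).1 ⟨h, h5⟩
  exact h.of_dvd (by norm_num [hM])

theorem five_mem_Nset_2214502422 : 5 ∈ Nset 2214502422 := by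
  refine ⟨by norm_num, ?_⟩
  obtain ⟨M, hM⟩ : ∃ M, M = 2214502422 * 5 := ⟨_, rfl⟩
  rw [← hM]
  have h2 : S M M ≡ 5 [MOD 2] :=
    S_self_modEq (k := 5536256055) (by norm_num) (by omega) (by omega) (by norm_num [hM]) (by norm_num)
  have h3 : S M M ≡ 5 [MOD 3] :=
    S_self_modEq (k := 3690837370) (by norm_num) (by omega) (by omega) (by norm_num [hM]) (by norm_num)
  have h5 : S M M ≡ 5 [MOD 5] :=
    S_self_modEq_zero (k := 2214502422) (by norm_num) (by omega) (by omega) (by norm_num [hM])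
  have h11 : S M M ≡ 5 [MOD 11] :=
    S_self_modEq (k := 1006592010) (by norm_num) (by omega) (by omega) (by norm_num [hM]) (by norm_num)
  have h23 : S M M ≡ 5 [MOD 23] :=
    S_self_modEq (k := 481413570) (by norm_num) (by omega) (by omega) (by norm_num [hM]) (by norm_num)
  have h31 : S M M ≡ 5 [MOD 31] :=
    S_self_modEq (k := 357177810) (by norm_num) (by omega) (by omega) (by norm_num [hM]) (by norm_num)
  have h47059 : S M M ≡ 5 [MOD 47059] :=
    S_self_modEq (k := 235290) (by norm_num) (by omega) (by omega) (by norm_num [hM]) (by norm_num)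
  have h := (Nat.modEq_and_modEq_iff_modEq_mul (by norm_num)).1 ⟨h2, h3⟩
  replace h := (Nat.modEq_and_modEq_iff_modEq_mul (by norm_num)).1 ⟨h, h11⟩
  replace h := (Nat.modEq_and_modEq_iff_modEq_mul (by norm_num)).1 ⟨h, h23⟩
  replace h := (Nat.modEq_and_modEq_iff_modEq_mul (by norm_num)).1 ⟨h, h31⟩
  replace h := (Nat.modEq_and_modEq_iff_modEq_mul (by norm_num)).1 ⟨h, h47059⟩
  replace h := (Nat.modEq_and_modEq_iff_modEq_mul (by norm_num)).1 ⟨h, h5⟩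
  exact h.of_dvd (by norm_num [hM])

theorem min_Nset_47058_2214502422 :
    ∀ Q ∈ ({47058, 2214502422} : Set ℕ),
      (Nset Q).Nonempty ∧ IsLeast (Nset Q) 5 := by
  rintro Q (rfl | rfl)
  · exact ⟨⟨5, five_mem_Nset_47058⟩, five_mem_Nset_47058, fun n hn =>
      five_le_of_mem_Nset (by norm_num) (by norm_num) (by norm_num) hn⟩
  · exact ⟨⟨5, five_mem_Nset_2214502422⟩, five_mem_Nset_2214502422, fun n hn =>
      five_le_of_mem_Nset (by norm_num) (by norm_num) (by norm_num) hn⟩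
end

section
/- For Q = 52495396602 there is no positive integer n satisfying S_{Qn}(Qn) ≡ n (mod Qn); that is, the set 𝔑_{52495396602} is empty. -/
/-- Modulo `k`, the power sum `S m k` runs over all residue classes. -/
theorem S_cast_eq_sum_zmod (m k : ℕ) [NeZero k] (hm : m ≠ 0) :
    (S m k : ZMod k) = ∑ x : ZMod k, x ^ m := by
  have hk : 0 < k := Nat.pos_of_neZero k
  have h1 : (S m k : ZMod k) = ∑ i ∈ Finset.range k, (i : ZMod k) ^ m := by
    have h : S m k = ∑ i ∈ Finset.range (k + 1), i ^ m := by
      refine Finset.sum_subset (fun i hi => ?_) fun i hi hi' => ?_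
      · simp only [Finset.mem_range, Finset.mem_Icc] at hi ⊢
        omega
      · have : i = 0 := by
          simp only [Finset.mem_range, Finset.mem_Icc] at hi hi'
          omega
        simp [this, hm]
    rw [h, Finset.sum_range_succ]
    simp [hm]
  rw [h1]
  refine Finset.sum_bij' (fun i _ => (i : ZMod k)) (fun x _ => x.val) ?_ ?_ ?_ ?_ ?_
  · simp
  · intro x _
    simpa using ZMod.val_lt x
  · intro i hi
    exact ZMod.val_cast_of_lt (Finset.mem_range.1 hi)
  · intro x _
    simp
  · simp

/-- If `p - 1` does not divide `k`, then `S k k` is divisible by every power of `p` dividing `k`. -/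
theorem pow_dvd_S_self {p k a : ℕ} (hp : p.Prime) (hk : 0 < k) (hpk : p ∣ k) (ha : p ^ a ∣ k)
    (h : ¬ (p - 1) ∣ k) : p ^ a ∣ S k k := by
  have : Fact p.Prime := ⟨hp⟩
  have : NeZero k := ⟨hk.ne'⟩
  have hex : ∃ u : (ZMod p)ˣ, u ^ k ≠ 1 := by
    by_contra! hall
    have := (FiniteField.forall_pow_eq_one_iff (ZMod p) k).1 hall
    rw [ZMod.card] at this
    exact h this
  obtain ⟨u, hu⟩ := hex
  obtain ⟨g, rfl⟩ := ZMod.unitsMap_surjective hpk u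
  have hsum : ((g : ZMod k) ^ k - 1) * (S k k : ZMod k) = 0 := by
    rw [S_cast_eq_sum_zmod k k hk.ne', sub_mul, one_mul, sub_eq_zero, Finset.mul_sum]
    simp_rw [← mul_pow]
    exact Equiv.sum_comp (Units.mulLeft g) fun x => x ^ k
  have hdvd : (k : ℤ) ∣ (((g : ZMod k).val : ℤ) ^ k - 1) * (S k k : ℤ) := by
    rw [← ZMod.intCast_zmod_eq_zero_iff_dvd]
    push_cast
    rw [ZMod.natCast_zmod_val]
    exact hsum
  have hnd : ¬ (p : ℤ) ∣ ((g : ZMod k).val : ℤ) ^ k - 1 := by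
    intro hd
    apply hu
    rw [← ZMod.intCast_zmod_eq_zero_iff_dvd] at hd
    push_cast at hd
    ext
    rw [Units.val_pow_eq_pow_val, ZMod.unitsMap_val, Units.val_one, ZMod.cast_eq_val]
    exact sub_eq_zero.1 hd
  have hco : IsCoprime ((p : ℤ) ^ a) (((g : ZMod k).val : ℤ) ^ k - 1) :=
    ((Nat.prime_iff_prime_int.1 hp).coprime_iff_not_dvd.2 hnd).pow_left
  have hpa : ((p : ℤ) ^ a) ∣ (k : ℤ) := by exact_mod_cast ha
  exact_mod_cast hco.dvd_of_dvd_mul_left (hpa.trans hdvd)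

/-- If `p - 1` divides `k`, then `S k k` counts the integers up to `k` prime to `p`,
modulo the exact power of `p` in `k`. -/
theorem S_self_modEq_s10 {p k a : ℕ} (hp : p.Prime) (hk : 0 < k) (ha : p ^ a ∣ k)
    (hco : ¬ p ∣ k / p ^ a) (h : (p - 1) ∣ k) :
    S k k ≡ k - k / p [MOD p ^ a] := by
  have hterm : ∀ i ∈ Finset.Icc 1 k, i ^ k ≡ (if p ∣ i then 0 else 1) [MOD p ^ a] := by
    intro i _
    split_ifs with hi
    · have hak : a ≤ k := (Nat.lt_pow_self hp.one_lt).le.trans (Nat.le_of_dvd hk ha)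
      exact (Nat.modEq_zero_iff_dvd).2 ((pow_dvd_pow p hak).trans (pow_dvd_pow_of_dvd hi k))
    · have hc : i.Coprime (p ^ a) := ((hp.coprime_iff_not_dvd.2 hi).symm).pow_right a
      have htot : (p ^ a).totient ∣ k := by
        rcases Nat.eq_zero_or_pos a with rfl | hpos
        · simp
        · rw [Nat.totient_prime_pow hp hpos]
          refine Nat.Coprime.mul_dvd_of_dvd_of_dvd ?_ ((pow_dvd_pow p (Nat.sub_le a 1)).trans ha) h
          refine Nat.Coprime.pow_left _ (hp.coprime_iff_not_dvd.2 fun hd => ?_)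
          have := Nat.le_of_dvd (Nat.sub_pos_of_lt hp.one_lt) hd
          have := hp.one_lt
          omega
      obtain ⟨c, hc'⟩ := htot
      have := (Nat.ModEq.pow_totient hc).pow c
      rwa [← pow_mul, ← hc', one_pow] at this
  have hcount : ∑ i ∈ Finset.Icc 1 k, (if p ∣ i then 0 else 1) = k - k / p := by
    have h1 : ∑ i ∈ Finset.Icc 1 k, (if p ∣ i then 0 else 1)
        + ∑ i ∈ Finset.Icc 1 k, (if p ∣ i then 1 else 0) = k := by
      rw [← Finset.sum_add_distrib]
      trans ∑ i ∈ Finset.Icc 1 k, 1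
      · refine Finset.sum_congr rfl fun i _ => ?_
        split_ifs <;> rfl
      · simp
    have h2 : ∑ i ∈ Finset.Icc 1 k, (if p ∣ i then 1 else 0) = k / p := by
      rw [← Finset.card_filter]
      exact Nat.Ioc_filter_dvd_card_eq_div k p
    omega
  rw [← hcount]
  exact Nat.ModEq.sum hterm

theorem Nset_52495396602_empty :
    ¬ ∃ n : ℕ, 0 < n ∧
      S (52495396602 * n) (52495396602 * n) ≡ n [MOD 52495396602 * n] := by
  rintro ⟨n, hn, hS⟩
  obtain ⟨k, hkdef⟩ : ∃ k, k = 52495396602 * n := ⟨_, rfl⟩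
  rw [← hkdef] at hS
  have hk : 0 < k := by omega
  have h100 : 100 ∣ k := by
    by_contra h
    obtain ⟨b, m, hm, hnm⟩ := Nat.exists_eq_pow_mul_and_not_dvd hn.ne' 101 (by norm_num)
    have hb : 101 ^ (b + 1) ∣ k := ⟨519756402 * m, by rw [hkdef, hnm]; ring⟩
    have hd := pow_dvd_S_self (by norm_num : Nat.Prime 101) hk (by omega) hb h
    have hdn : 101 ^ (b + 1) ∣ n := (hS.dvd_iff hb).1 hd
    rw [hnm, pow_succ] at hdn
    exact hm (Nat.dvd_of_mul_dvd_mul_left (by positivity) hdn)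
  obtain ⟨a, m, hm, hnm⟩ := Nat.exists_eq_pow_mul_and_not_dvd hn.ne' 5 (by norm_num)
  have hkm : k = 5 ^ a * (52495396602 * m) := by rw [hkdef, hnm]; ring
  have ha : 5 ^ a ∣ k := ⟨_, hkm⟩
  have hdiv : k / 5 ^ a = 52495396602 * m := by
    rw [hkm, Nat.mul_div_cancel_left _ (by positivity)]
  have hp : Nat.Prime 5 := by norm_num
  have hco : ¬ 5 ∣ 52495396602 * m := hp.not_dvd_mul (by norm_num) hm
  have hmod := S_self_modEq_s10 hp hk ha (hdiv ▸ hco) ((by norm_num : 5 - 1 ∣ 100).trans h100)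
  have hdS : 5 ^ a ∣ S k k := (hS.dvd_iff ha).2 ⟨m, hnm⟩
  have hd : 5 ^ a ∣ k - k / 5 := (hmod.dvd_iff dvd_rfl).1 hdS
  cases a with
  | zero => omega
  | succ a =>
    have hval : k - k / 5 = 5 ^ a * (4 * (52495396602 * m)) := by
      rw [pow_succ, mul_assoc, mul_left_comm] at hkm
      rw [mul_left_comm (5 ^ a)]
      omega
    rw [hval, pow_succ] at hd
    exact hp.not_dvd_mul (by norm_num) hco (Nat.dvd_of_mul_dvd_mul_left (by positivity) hd)
end

section
/- Let Q be a weak primary pseudoperfect number with 𝔑_Q non-empty, and let 𝔫_Q := lcm{(p-1)/gcd(p-1,Q) : p prime, p | Q} if Q ≠ 1 and 𝔫_Q := 1 if Q = 1. Then the set difference 𝔫_Q·ℕ \ 𝔑_Q equals the union over all divisors d of Q of the sets W_d(Q) := { K · p · (𝔫_Q/D) · ((p-1)/d) : p prime, p ∤ Q, d | p-1, D = gcd(𝔫_Q, p(p-1)/d), K a positive integer }. -/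
/-- The integer `𝔫_Q = lcm {(p-1)/gcd(p-1,Q) : prime p ∣ Q}` (which is `1` for `Q = 1`,
the lcm over the empty set). -/
def nQ (Q : ℕ) : ℕ := Q.primeFactors.lcm (fun p => (p - 1) / Nat.gcd (p - 1) Q)

/-- The set `W_d(Q)`. -/
def W (d Q : ℕ) : Set ℕ :=
  {m | ∃ p K : ℕ, Nat.Prime p ∧ ¬ p ∣ Q ∧ d ∣ p - 1 ∧ 0 < K ∧
    m = K * p * (nQ Q / Nat.gcd (nQ Q) (p * (p - 1) / d)) * ((p - 1) / d)}

theorem sum_range_mul_natCast_zmod {N : ℕ} [NeZero N] (c : ℕ) (f : ZMod N → ZMod N) :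
    ∑ i ∈ Finset.range (N * c), f i = c * ∑ x, f x := by
  induction c with
  | zero => simp
  | succ c ih =>
    have hblock : ∑ i ∈ Finset.range N, f i = ∑ x, f x := by
      obtain ⟨n, rfl⟩ := Nat.exists_eq_succ_of_ne_zero (NeZero.ne N)
      rw [Finset.sum_range]
      exact Finset.sum_congr rfl fun x _ => congrArg f (Fin.cast_val_eq_self x)
    rw [Nat.mul_succ, Finset.sum_range_add, ih]
    simp only [Nat.cast_add, Nat.cast_mul, CharP.cast_eq_zero, zero_mul, zero_add, hblock]
    push_cast
    ring

theorem natCast_S_self {N M : ℕ} [NeZero N] (hM : 0 < M) (h : N ∣ M) :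
    (S M M : ZMod N) = (M / N : ℕ) * ∑ x : ZMod N, x ^ M := by
  have hMN : (M : ZMod N) = 0 := (ZMod.natCast_eq_zero_iff _ _).2 h
  have hshift := (Finset.sum_range_succ' (fun i : ℕ => (i : ZMod N) ^ M) M).symm.trans
    (Finset.sum_range_succ (fun i : ℕ => (i : ZMod N) ^ M) M)
  simp only [hMN, Nat.cast_zero, zero_pow hM.ne', add_zero] at hshift
  rw [← sum_range_mul_natCast_zmod (M / N) (fun x => x ^ M), Nat.mul_div_cancel' h, ← hshift, S,
    Nat.cast_sum, ← Finset.Ico_add_one_right_eq_Icc, Finset.sum_Ico_eq_sum_range]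
  simp [add_comm]

/-- The sum of the `M`-th powers over `ZMod (p ^ k)` when `p - 1 ∣ M` and `p ^ k ∣ M`. -/
theorem sum_pow_zmod_of_dvd {p k M : ℕ} [Fact p.Prime] (hk : k ≠ 0) (hM : 0 < M)
    (h : p ^ k ∣ M) (hp1 : p - 1 ∣ M) :
    ∑ x : ZMod (p ^ k), x ^ M = (Nat.totient (p ^ k) : ZMod (p ^ k)) := by
  classical
  have hp : p.Prime := Fact.out
  have htot : Nat.totient (p ^ k) ∣ M := by
    rw [Nat.totient_prime_pow hp (Nat.pos_of_ne_zero hk)]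
    refine Nat.Coprime.mul_dvd_of_dvd_of_dvd ?_ ((pow_dvd_pow p (Nat.sub_le k 1)).trans h) hp1
    exact Nat.Coprime.pow_left _ <| (Nat.coprime_self_sub_right hp.one_le).2 (Nat.coprime_one_right p)
  have key : ∀ x : ZMod (p ^ k), x ^ M = if IsUnit x then 1 else 0 := by
    intro x
    split_ifs with hx
    · obtain ⟨u, rfl⟩ := hx
      obtain ⟨c, rfl⟩ := htot
      rw [← Units.val_pow_eq_pow_val, pow_mul, ZMod.pow_totient, one_pow, Units.val_one]
    · rw [← ZMod.natCast_zmod_val x, ZMod.isUnit_iff_coprime, Nat.coprime_pow_right_iff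
        (Nat.pos_of_ne_zero hk), Nat.coprime_comm, hp.coprime_iff_not_dvd, not_not] at hx
      rw [← ZMod.natCast_zmod_val x, ← Nat.cast_pow, ZMod.natCast_eq_zero_iff]
      have hkM : k ≤ M := (Nat.lt_pow_self hp.one_lt).le.trans (Nat.le_of_dvd hM h)
      exact (pow_dvd_pow p hkM).trans (pow_dvd_pow_of_dvd hx M)
  rw [Finset.sum_congr rfl fun x _ => key x, Finset.sum_boole, ← ZMod.card_units_eq_totient,
    ← Fintype.card_subtype]
  exact congrArg _ (Fintype.card_congr (Equiv.ofBijective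
    (fun x : {x : ZMod (p ^ k) // IsUnit x} => x.2.unit)
    ⟨fun x y h => Subtype.ext (by simpa using congrArg Units.val h),
      fun u => ⟨⟨u, u.isUnit⟩, Units.ext rfl⟩⟩))

/-- The sum of the `M`-th powers over `ZMod (p ^ k)` when `p - 1 ∤ M`. -/
theorem sum_pow_zmod_of_not_dvd {p k M : ℕ} [Fact p.Prime] (hp1 : ¬ p - 1 ∣ M) :
    ∑ x : ZMod (p ^ k), x ^ M = 0 := by
  have hp : p.Prime := Fact.out
  obtain ⟨u, hu⟩ : ∃ u : (ZMod p)ˣ, u ^ M ≠ 1 := by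
    have := (FiniteField.forall_pow_eq_one_iff (ZMod p) M).not
    rw [ZMod.card] at this
    simpa using this.2 hp1
  set a := (u : ZMod p).val with ha
  have hau : (a : ZMod p) = u := ZMod.natCast_zmod_val _
  have hunit : ∀ b : ℕ, (b : ZMod p) ≠ 0 → IsUnit (b : ZMod (p ^ k)) := fun b hb => by
    rw [ZMod.isUnit_iff_coprime]
    refine Nat.Coprime.pow_right _ (Nat.coprime_comm.1 (hp.coprime_iff_not_dvd.2 ?_))
    rwa [Ne, ZMod.natCast_eq_zero_iff] at hb
  obtain ⟨v, hv⟩ := hunit a (hau ▸ u.ne_zero)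
  have ha1 : 1 ≤ a ^ M := by
    refine Nat.one_le_pow _ _ (Nat.pos_of_ne_zero fun h => u.ne_zero ?_)
    rw [← hau, h, Nat.cast_zero]
  have hsub : IsUnit ((a ^ M - 1 : ℕ) : ZMod (p ^ k)) := by
    refine hunit _ ?_
    rw [Nat.cast_sub ha1, Nat.cast_pow, hau, Nat.cast_one, sub_ne_zero]
    exact fun h => hu (Units.ext (by simpa using h))
  have hinv : ∑ x : ZMod (p ^ k), x ^ M = (a : ZMod (p ^ k)) ^ M * ∑ x : ZMod (p ^ k), x ^ M := by
    rw [Finset.mul_sum, ← Equiv.sum_comp (Units.mulLeft v)]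
    simp [hv, mul_pow]
  refine hsub.mul_right_eq_zero.1 ?_
  rw [Nat.cast_sub ha1, Nat.cast_pow, Nat.cast_one, sub_mul, one_mul, ← hinv, sub_self]

/-- The local form of the congruence `S_M(M) ≡ -∑_{p ∣ M, p - 1 ∣ M} M / p (mod M)`. -/
theorem prime_pow_dvd_S_self_add {p k M : ℕ} (hp : p.Prime) (hk : k ≠ 0) (hM : 0 < M)
    (h : p ^ k ∣ M) : p ^ k ∣ S M M + if p - 1 ∣ M then M / p else 0 := by
  have : Fact p.Prime := ⟨hp⟩
  rw [← ZMod.natCast_eq_zero_iff, Nat.cast_add, natCast_S_self hM h]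
  split_ifs with hp1
  · rw [sum_pow_zmod_of_dvd hk hM h hp1, ← Nat.cast_mul, ← Nat.cast_add,
      ZMod.natCast_eq_zero_iff, Nat.totient_prime_pow hp (Nat.pos_of_ne_zero hk)]
    obtain ⟨c, rfl⟩ := h
    obtain ⟨j, rfl⟩ := Nat.exists_eq_succ_of_ne_zero hk
    obtain ⟨q, rfl⟩ : ∃ q, p = q + 1 := ⟨p - 1, (Nat.sub_add_cancel hp.one_le).symm⟩
    rw [Nat.mul_div_cancel_left _ (pow_pos hp.pos _)]
    have : (q + 1) ^ (j + 1) * c / (q + 1) = (q + 1) ^ j * c := by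
      rw [pow_succ, mul_right_comm, Nat.mul_div_cancel _ hp.pos]
    simp only [Nat.succ_eq_add_one, this, Nat.add_sub_cancel]
    exact ⟨c, by ring⟩
  · rw [sum_pow_zmod_of_not_dvd hp1]
    simp

theorem prime_dvd_div_add_one {Q p : ℕ}
    (hw : (∑ p ∈ Q.primeFactors, Q / p) + 1 ≡ 0 [MOD Q]) (hp : p ∈ Q.primeFactors) :
    p ∣ Q / p + 1 := by
  have hpQ := Nat.dvd_of_mem_primeFactors hp
  have hdvd : p ∣ (∑ q ∈ Q.primeFactors, Q / q) + 1 :=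
    hpQ.trans ((Nat.modEq_zero_iff_dvd).1 hw)
  rw [← Finset.add_sum_erase _ _ hp, add_right_comm] at hdvd
  refine (Nat.dvd_add_left (Finset.dvd_sum fun q hq => ?_)).1 hdvd
  obtain ⟨hqp, hq⟩ := Finset.mem_erase.1 hq
  have hq' := Nat.prime_of_mem_primeFactors hq
  have hp' := Nat.prime_of_mem_primeFactors hp
  exact Nat.dvd_div_of_mul_dvd (((Nat.coprime_primes hq' hp').2 hqp).mul_dvd_of_dvd_of_dvd
    (Nat.dvd_of_mem_primeFactors hq) hpQ)

theorem div_gcd_dvd_iff {r Q m : ℕ} (hQ : 0 < Q) : r / Nat.gcd r Q ∣ m ↔ r ∣ Q * m := by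
  have hg : 0 < Nat.gcd r Q := Nat.gcd_pos_of_pos_right _ hQ
  constructor
  · intro h
    rw [← Nat.mul_div_cancel' (Nat.gcd_dvd_left r Q)]
    exact mul_dvd_mul (Nat.gcd_dvd_right r Q) h
  · intro h
    refine (Nat.coprime_div_gcd_div_gcd hg).dvd_of_dvd_mul_left ?_
    rw [← Nat.mul_dvd_mul_iff_left hg, ← mul_assoc, Nat.mul_div_cancel' (Nat.gcd_dvd_left r Q),
      Nat.mul_div_cancel' (Nat.gcd_dvd_right r Q)]
    exact h

theorem nQ_dvd_iff {Q n : ℕ} (hQ : 0 < Q) :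
    nQ Q ∣ n ↔ ∀ p ∈ Q.primeFactors, p - 1 ∣ Q * n := by
  rw [nQ, Finset.lcm_dvd_iff]
  exact forall₂_congr fun p _ => div_gcd_dvd_iff hQ

theorem nQ_pos (Q : ℕ) : 0 < nQ Q := by
  refine Nat.pos_of_ne_zero fun h => ?_
  obtain ⟨p, hp, h0⟩ := Finset.lcm_eq_zero_iff.1 h
  have := (Nat.prime_of_mem_primeFactors hp).two_le
  exact (Nat.div_pos (Nat.gcd_le_left Q (by omega)) (Nat.gcd_pos_of_pos_left Q (by omega))).ne' h0

theorem mem_Nset_iff {Q n : ℕ} (hQ : 0 < Q)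
    (hw : (∑ p ∈ Q.primeFactors, Q / p) + 1 ≡ 0 [MOD Q]) (hn : 0 < n) :
    n ∈ Nset Q ↔ nQ Q ∣ n ∧ ∀ p : ℕ, p.Prime → ¬ p ∣ Q → p ∣ n → ¬ p - 1 ∣ Q * n := by
  have hM : 0 < Q * n := Nat.mul_pos hQ hn
  have hiff : n ∈ Nset Q ↔ ∀ p k : ℕ, p.Prime → k ≠ 0 → p ^ k ∣ Q * n →
      p ^ k ∣ n + if p - 1 ∣ Q * n then Q * n / p else 0 := by
    have : n ∈ Nset Q ↔ Q * n ∣ ((n : ℤ) - S (Q * n) (Q * n)).natAbs := by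
      rw [← Int.natCast_dvd, ← Nat.modEq_iff_dvd]
      exact and_iff_right hn
    rw [this, Nat.dvd_iff_prime_pow_dvd_dvd]
    refine forall₂_congr fun p k => forall_congr' fun hp => ?_
    rcases eq_or_ne k 0 with rfl | hk
    · simp
    simp only [hk, ne_eq, not_false_eq_true, forall_const]
    refine forall_congr' fun hpk => ?_
    have hS := prime_pow_dvd_S_self_add hp hk hM hpk
    rw [← Int.natCast_dvd, ← Int.natCast_dvd_natCast (n := n + _)]
    rw [← Int.natCast_dvd_natCast] at hS
    rw [Nat.cast_add] at hS ⊢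
    rw [← dvd_add_left hS]
    ring_nf
  rw [hiff, nQ_dvd_iff hQ]
  constructor
  · intro h
    have hmax : ∀ p : ℕ, p.Prime → p ∣ Q * n → ∃ k, k ≠ 0 ∧ p ^ k ∣ Q * n ∧
        ¬ p ^ k * p ∣ Q * n := fun p hp hpM =>
      ⟨(Q * n).factorization p, (hp.factorization_pos_of_dvd hM.ne' hpM).ne',
        Nat.ordProj_dvd _ _, Nat.pow_succ_factorization_not_dvd hM.ne' hp⟩
    refine ⟨fun p hp => ?_, fun p hp hpQ hpn hp1 => ?_⟩
    · have hpQ := Nat.dvd_of_mem_primeFactors hp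
      have hp' := Nat.prime_of_mem_primeFactors hp
      obtain ⟨k, hk, hk1, hk2⟩ := hmax p hp' (hpQ.mul_right n)
      by_contra hp1
      have := h p k hp' hk hk1
      rw [if_neg hp1, add_zero] at this
      exact hk2 (mul_comm Q n ▸ mul_dvd_mul this hpQ)
    · obtain ⟨k, hk, hk1, hk2⟩ := hmax p hp (hpn.mul_left Q)
      have hkn : p ^ k ∣ n :=
        (((hp.coprime_iff_not_dvd.2 hpQ).pow_left k).dvd_of_dvd_mul_left hk1)
      have := h p k hp hk hk1
      rw [if_pos hp1, Nat.dvd_add_right hkn] at this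
      exact hk2 (mul_comm p (p ^ k) ▸ Nat.mul_dvd_of_dvd_div (hpn.mul_left Q) this)
  · rintro ⟨h1, h2⟩ p k hp hk hpk
    by_cases hpQ : p ∣ Q
    · have hmem : p ∈ Q.primeFactors := Nat.mem_primeFactors.2 ⟨hp, hpQ, hQ.ne'⟩
      have hw' := prime_dvd_div_add_one hw hmem
      rw [if_pos (h1 p hmem)]
      obtain ⟨q, rfl⟩ := hpQ
      obtain ⟨j, rfl⟩ := Nat.exists_eq_succ_of_ne_zero hk
      rw [Nat.mul_div_cancel_left _ hp.pos] at hw'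
      rw [mul_assoc, Nat.mul_div_cancel_left _ hp.pos]
      have hpq : ¬ p ∣ q := fun h => hp.one_lt.ne' (Nat.dvd_one.1 ((Nat.dvd_add_right h).1 hw'))
      rw [Nat.succ_eq_add_one, pow_succ', mul_assoc, Nat.mul_dvd_mul_iff_left hp.pos] at hpk
      have hjn := ((hp.coprime_iff_not_dvd.2 hpq).pow_left j).dvd_of_dvd_mul_left hpk
      have := mul_dvd_mul hjn hw'
      rwa [← pow_succ, mul_add, mul_one, mul_comm n q, add_comm (q * n)] at this
    · have hkn : p ^ k ∣ n :=
        (((hp.coprime_iff_not_dvd.2 hpQ).pow_left k).dvd_of_dvd_mul_left hpk)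
      rw [if_neg (h2 p hp hpQ ((dvd_pow_self p hk).trans hkn)), add_zero]
      exact hkn

theorem mem_W_iff {d Q m : ℕ} (hm : 0 < m) :
    m ∈ W d Q ↔ ∃ p : ℕ, p.Prime ∧ ¬ p ∣ Q ∧ d ∣ p - 1 ∧ nQ Q ∣ m ∧ p ∣ m ∧ (p - 1) / d ∣ m := by
  refine exists_congr fun p => ?_
  constructor
  · rintro ⟨K, hp, hpQ, hdp, hK, hmK⟩
    have hlcm : m = K * Nat.lcm (nQ Q) (p * ((p - 1) / d)) := by
      rw [hmK, Nat.mul_div_assoc p hdp, Nat.lcm, Nat.mul_div_right_comm (Nat.gcd_dvd_left _ _)]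
      ring
    have hdvd : Nat.lcm (nQ Q) (p * ((p - 1) / d)) ∣ m := ⟨K, by rw [hlcm, mul_comm]⟩
    have h2 := (Nat.dvd_lcm_right _ _).trans hdvd
    exact ⟨hp, hpQ, hdp, (Nat.dvd_lcm_left _ _).trans hdvd, (dvd_mul_right _ _).trans h2,
      (dvd_mul_left _ _).trans h2⟩
  · rintro ⟨hp, hpQ, hdp, h1, h2, h3⟩
    have hcop : Nat.Coprime p ((p - 1) / d) :=
      ((Nat.coprime_self_sub_right hp.one_le).2 (Nat.coprime_one_right p)).of_dvd_right
        (Nat.div_dvd_of_dvd hdp)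
    obtain ⟨K, hK⟩ := Nat.lcm_dvd h1 (hcop.mul_dvd_of_dvd_of_dvd h2 h3)
    refine ⟨K, hp, hpQ, hdp, Nat.pos_of_ne_zero ?_, ?_⟩
    · rintro rfl
      exact hm.ne' hK
    · rw [hK, Nat.mul_div_assoc p hdp, Nat.lcm, Nat.mul_div_right_comm (Nat.gcd_dvd_left _ _)]
      ring

theorem pos_of_mem_W {d Q m : ℕ} (hm : m ∈ W d Q) : 0 < m := by
  obtain ⟨p, K, hp, -, hdp, hK, rfl⟩ := hm
  have hp1 : 0 < p - 1 := Nat.sub_pos_of_lt hp.one_lt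
  have hg : 0 < Nat.gcd (nQ Q) (p * (p - 1) / d) := Nat.gcd_pos_of_pos_left _ (nQ_pos Q)
  exact Nat.mul_pos (Nat.mul_pos (Nat.mul_pos hK hp.pos)
    (Nat.div_pos (Nat.gcd_le_left _ (nQ_pos Q)) hg))
    (Nat.div_pos (Nat.le_of_dvd hp1 hdp) (Nat.pos_of_dvd_of_pos hdp hp1))

theorem exists_divisor_dvd_iff {Q m r : ℕ} (hQ : 0 < Q) :
    (∃ d ∈ Nat.divisors Q, d ∣ r ∧ r / d ∣ m) ↔ r ∣ Q * m := by
  constructor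
  · rintro ⟨d, hd, hdr, h⟩
    rw [← Nat.mul_div_cancel' hdr]
    exact mul_dvd_mul (Nat.dvd_of_mem_divisors hd) h
  · intro h
    refine ⟨Nat.gcd r Q, Nat.mem_divisors.2 ⟨Nat.gcd_dvd_right _ _, hQ.ne'⟩,
      Nat.gcd_dvd_left _ _, (div_gcd_dvd_iff hQ).2 h⟩

theorem complement_decomposition (Q : ℕ) (hQ : 0 < Q)
    (hw : (∑ p ∈ Q.primeFactors, Q / p) + 1 ≡ 0 [MOD Q])
    (hne : (Nset Q).Nonempty) :
    {m : ℕ | ∃ K : ℕ, 0 < K ∧ m = K * nQ Q} \ Nset Q =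
      ⋃ d ∈ Nat.divisors Q, W d Q := by
  ext m
  rcases Nat.eq_zero_or_pos m with rfl | hm
  · refine iff_of_false ?_ ?_
    · rintro ⟨⟨K, hK, h0⟩, -⟩
      exact (Nat.mul_pos hK (nQ_pos Q)).ne h0
    · simp only [Set.mem_iUnion, not_exists]
      exact fun d _ h => (pos_of_mem_W h).ne rfl
  have hmul : (∃ K : ℕ, 0 < K ∧ m = K * nQ Q) ↔ nQ Q ∣ m :=
    ⟨fun ⟨K, _, h⟩ => h ▸ dvd_mul_left _ _, fun ⟨K, h⟩ => ⟨K, Nat.pos_of_ne_zero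
      (by rintro rfl; exact hm.ne' h), h.trans (mul_comm _ _)⟩⟩
  rw [Set.mem_sdiff, Set.mem_ofPred_eq, hmul, mem_Nset_iff hQ hw hm]
  simp only [Set.mem_iUnion]
  constructor
  · rintro ⟨h1, h2⟩
    simp only [h1, true_and, not_forall, not_not] at h2
    obtain ⟨p, hp, hpQ, hpm, hp1⟩ := h2
    obtain ⟨d, hd, hdp, hdm⟩ := (exists_divisor_dvd_iff hQ).2 hp1
    exact ⟨d, hd, (mem_W_iff hm).2 ⟨p, hp, hpQ, hdp, h1, hpm, hdm⟩⟩
  · rintro ⟨d, hd, h⟩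
    obtain ⟨p, hp, hpQ, hdp, h1, hpm, hdm⟩ := (mem_W_iff hm).1 h
    exact ⟨h1, fun h2 => h2.2 p hp hpQ hpm ((exists_divisor_dvd_iff hQ).1 ⟨d, hd, hdp, hdm⟩)⟩
end

section
/- Let Q ∈ {47058, 2214502422}. Then the set difference 5ℕ \ 𝔑_Q equals the union, over all divisors d of Q, of the sets W^(1)_d(Q) ∪ W^(2)_d(Q), where W^(1)_d(Q) := { K · p(p-1)/d : p prime, p ∤ Q, 5 | p(p-1), d | p-1, K a positive integer } and W^(2)_d(Q) := { 5K · p(p-1)/d : p prime, p ∤ Q, 5 ∤ p(p-1), d | p-1, K a positive integer }. -/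
/-- The set `W^(1)_d(Q)`. -/
def W1 (d Q : ℕ) : Set ℕ :=
  {m | ∃ p K : ℕ, Nat.Prime p ∧ ¬ p ∣ Q ∧ 5 ∣ p * (p - 1) ∧ d ∣ p - 1 ∧ 0 < K ∧
    m = K * (p * (p - 1) / d)}

/-- The set `W^(2)_d(Q)`. -/
def W2 (d Q : ℕ) : Set ℕ :=
  {m | ∃ p K : ℕ, Nat.Prime p ∧ ¬ p ∣ Q ∧ ¬ 5 ∣ p * (p - 1) ∧ d ∣ p - 1 ∧ 0 < K ∧
    m = 5 * K * (p * (p - 1) / d)}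

open Finset in
theorem sq_dvd_sum_range_mul_pow_sub (m q t : ℕ) :
    (q : ℤ) ^ 2 ∣ ∑ i ∈ range (q * t), (i : ℤ) ^ m - t * ∑ i ∈ range q, (i : ℤ) ^ m
      - m * q * (∑ j ∈ range t, (j : ℤ)) * ∑ i ∈ range q, (i : ℤ) ^ (m - 1) := by
  induction t with
  | zero => simp
  | succ t ih =>
    have hblock : (q : ℤ) ^ 2 ∣ ∑ i ∈ range q, (((i : ℤ) + q * t) ^ m -
        ((i : ℤ) ^ m + m * (i : ℤ) ^ (m - 1) * (q * t))) := by
      refine dvd_sum fun i _ => ?_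
      obtain ⟨k, hk⟩ := Polynomial.powAddExpansion (i : ℤ) (q * t) m
      exact ⟨k * t ^ 2, by rw [hk]; ring⟩
    refine (dvd_add ih hblock).trans (dvd_of_eq (Eq.symm ?_))
    rw [Nat.mul_succ, sum_range_add, sum_range_succ _ t, sum_sub_distrib, sum_add_distrib,
      ← sum_mul, ← mul_sum]
    have hcomm : ∑ x ∈ range q, ((q * t + x : ℕ) : ℤ) ^ m =
        ∑ x ∈ range q, ((x : ℤ) + q * t) ^ m :=
      sum_congr rfl fun x _ => by push_cast; ring
    rw [hcomm]
    push_cast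
    ring

open Finset in
theorem dvd_sum_range_mul_pow_sub (m q t : ℕ) :
    (q : ℤ) ∣ ∑ i ∈ range (q * t), (i : ℤ) ^ m - t * ∑ i ∈ range q, (i : ℤ) ^ m := by
  have h := (dvd_pow_self (q : ℤ) two_ne_zero).trans (sq_dvd_sum_range_mul_pow_sub m q t)
  have h' : (q : ℤ) ∣ m * q * (∑ j ∈ range t, (j : ℤ)) * ∑ i ∈ range q, (i : ℤ) ^ (m - 1) :=
    ⟨m * (∑ j ∈ range t, (j : ℤ)) * ∑ i ∈ range q, (i : ℤ) ^ (m - 1), by ring⟩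
  simpa using dvd_add h h'

open Finset in
theorem natCast_dvd_mul_sum_range_id_of_even {m : ℕ} (hm : Even m) (p : ℕ) :
    (p : ℤ) ∣ m * ∑ j ∈ range p, (j : ℤ) := by
  obtain ⟨r, rfl⟩ := hm
  have h := sum_range_id_mul_two p
  refine Int.natCast_dvd_natCast.mpr (?_ : p ∣ (r + r) * ∑ j ∈ range p, j) |>.trans ?_
  · exact ⟨r * (p - 1), by linear_combination r * h⟩
  · push_cast; rfl

open Finset in
theorem Nat.Prime.dvd_sum_range_pow_add_ite {p : ℕ} (hp : p.Prime) {m : ℕ} (hm : m ≠ 0) :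
    (p : ℤ) ∣ ∑ i ∈ range p, (i : ℤ) ^ m + if p - 1 ∣ m then 1 else 0 := by
  have := Fact.mk hp
  rw [← ZMod.intCast_zmod_eq_zero_iff_dvd]
  have hbij : ∑ v ∈ Ico 1 p, (v : ZMod p) ^ m = ∑ u : (ZMod p)ˣ, (u : ZMod p) ^ m :=
    Finset.sum_bij'
      (fun v hv ↦ Units.mk0 (v : ZMod p) (mt (ZMod.natCast_eq_zero_iff v p).mp (by
        grind [Nat.not_dvd_of_pos_of_lt])))
      (fun u _ ↦ (u : ZMod p).val)
      (fun _ _ ↦ Finset.mem_univ _)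
      (fun u _ ↦ by grind [u.ne_zero, ZMod.val_ne_zero, ZMod.val_lt])
      (fun v hv ↦ by simp [ZMod.val_cast_of_lt (Finset.mem_Ico.mp hv).2])
      (fun u _ ↦ Units.ext (ZMod.natCast_zmod_val _))
      (fun _ _ ↦ rfl)
  push_cast
  rw [range_eq_Ico, sum_eq_sum_Ico_succ_bot hp.pos, hbij, FiniteField.sum_pow_units, ZMod.card]
  split_ifs <;> simp [hm]

open Finset in
/-- For even `m > 0`, the sum of the `m`-th powers below `p ^ (a + 1)` is
`-[p - 1 ∣ m] p ^ a` modulo `p ^ (a + 1)`. -/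
theorem Nat.Prime.pow_dvd_sum_range_pow_add_ite {p : ℕ} (hp : p.Prime) {m : ℕ} (hm : m ≠ 0)
    (hm2 : Even m) (a : ℕ) :
    (p : ℤ) ^ (a + 1) ∣
      ∑ i ∈ range (p ^ (a + 1)), (i : ℤ) ^ m + (if p - 1 ∣ m then 1 else 0) * p ^ a := by
  induction a with
  | zero => simpa using hp.dvd_sum_range_pow_add_ite hm
  | succ a ih =>
    have h1 := sq_dvd_sum_range_mul_pow_sub m (p ^ (a + 1)) p
    rw [← pow_succ] at h1
    have h2 : (p : ℤ) ^ (a + 1 + 1) ∣ ((p ^ (a + 1) : ℕ) : ℤ) ^ 2 := by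
      rw [Nat.cast_pow, ← pow_mul]
      exact pow_dvd_pow _ (by lia)
    have h3 := mul_dvd_mul ih (dvd_refl (p : ℤ))
    rw [← pow_succ] at h3
    obtain ⟨c, hc⟩ := natCast_dvd_mul_sum_range_id_of_even hm2 p
    have h4 : (p : ℤ) ^ (a + 1 + 1) ∣ m * (p ^ (a + 1) : ℕ) * (∑ j ∈ range p, (j : ℤ)) *
        ∑ i ∈ range (p ^ (a + 1)), (i : ℤ) ^ (m - 1) := by
      refine ⟨c * ∑ i ∈ range (p ^ (a + 1)), (i : ℤ) ^ (m - 1), ?_⟩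
      rw [mul_right_comm (m : ℤ), hc]
      push_cast
      ring
    refine (dvd_add (dvd_add (h2.trans h1) h4) h3).trans (dvd_of_eq (Eq.symm ?_))
    ring

open Finset in
/-- The power sum `S N N` modulo a prime power `p ^ (a + 1)` dividing the even number `N`. -/
theorem Nat.Prime.pow_dvd_S_add_ite {p : ℕ} (hp : p.Prime) {N a k : ℕ} (hN : N ≠ 0)
    (hN2 : Even N) (hk : N = p ^ (a + 1) * k) :
    (p : ℤ) ^ (a + 1) ∣ (S N N : ℤ) + (if p - 1 ∣ N then 1 else 0) * (p ^ a * k) := by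
  have hS : (S N N : ℤ) = ∑ i ∈ range N, (i : ℤ) ^ N + (N : ℤ) ^ N := by
    have h := sum_range_succ (fun i : ℕ => (i : ℤ) ^ N) N
    rw [range_eq_Ico, sum_eq_sum_Ico_succ_bot (Nat.succ_pos N)] at h
    simp only [Nat.cast_zero, zero_pow hN, zero_add] at h
    rw [← h, S]
    push_cast
    rfl
  have h1 := dvd_sum_range_mul_pow_sub N (p ^ (a + 1)) k
  rw [← hk] at h1
  push_cast at h1
  have h2 : (p : ℤ) ^ (a + 1) ∣ (N : ℤ) ^ N :=
    (show (p : ℤ) ^ (a + 1) ∣ (N : ℤ) from ⟨k, by exact_mod_cast hk⟩).trans (dvd_pow_self _ hN)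
  have h3 := (hp.pow_dvd_sum_range_pow_add_ite hN hN2 a).mul_left (k : ℤ)
  rw [hS]
  refine (dvd_add (dvd_add h1 h3) h2).trans (dvd_of_eq (Eq.symm ?_))
  ring

/-- If `Q` is even, `p ∣ Q / p + 1` for all primes `p ∣ Q`, and `p - 1 ∣ Q * n` for these primes,
then `n ∉ Nset Q` exactly when some prime `p ∣ n` not dividing `Q` satisfies `p - 1 ∣ Q * n`. -/
theorem notMem_Nset_iff {Q n : ℕ} (hQ : Q ≠ 0) (hn : 0 < n) (hQ2 : Even Q)
    (hQp : ∀ p, p.Prime → p ∣ Q → p ∣ Q / p + 1 ∧ p - 1 ∣ Q * n) :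
    n ∉ Nset Q ↔ ∃ p, p.Prime ∧ ¬ p ∣ Q ∧ p ∣ n ∧ p - 1 ∣ Q * n := by
  have hN : Q * n ≠ 0 := mul_ne_zero hQ hn.ne'
  have hN2 : Even (Q * n) := hQ2.mul_right n
  constructor
  · intro h
    by_contra! hbad
    refine h ⟨hn, Nat.ModEq.symm ?_⟩
    rw [Nat.modEq_iff_dvd, Int.natCast_dvd,
      Nat.dvd_iff_prime_pow_dvd_dvd]
    rintro p (_ | a) hp ⟨k, hk⟩
    · simp
    rw [← Int.natCast_dvd, Nat.cast_pow]
    have hS := hp.pow_dvd_S_add_ite hN hN2 hk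
    by_cases hpQ : p ∣ Q
    · obtain ⟨hpq, hpN⟩ := hQp p hp hpQ
      obtain ⟨q, rfl⟩ := hpQ
      rw [Nat.mul_div_cancel_left _ hp.pos] at hpq
      rw [if_pos hpN, one_mul] at hS
      have hqn : q * n = p ^ a * k :=
        Nat.eq_of_mul_eq_mul_left hp.pos (by rw [← mul_assoc, hk]; ring)
      have hcop : Nat.Coprime p q := by
        rw [hp.coprime_iff_not_dvd]
        intro hdvd
        exact hp.one_lt.ne' (Nat.dvd_one.mp ((Nat.dvd_add_right hdvd).mp hpq))
      have hna : p ^ a ∣ n := (hcop.pow_left a).dvd_of_dvd_mul_left ⟨k, hqn⟩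
      have h1 : (p : ℤ) ^ (a + 1) ∣ ((n * (q + 1) : ℕ) : ℤ) := by
        rw [pow_succ]
        exact_mod_cast mul_dvd_mul hna hpq
      have hqn' : (q : ℤ) * n = p ^ a * k := by exact_mod_cast hqn
      refine (dvd_sub hS h1).trans (dvd_of_eq (Eq.symm ?_))
      push_cast
      linear_combination hqn'
    · have hpn : p ^ (a + 1) ∣ n :=
        (((hp.coprime_iff_not_dvd).mpr hpQ).pow_left _).dvd_of_dvd_mul_left ⟨k, hk⟩
      have hpN := hbad p hp hpQ ((dvd_pow_self p a.succ_ne_zero).trans hpn)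
      rw [if_neg hpN, zero_mul, add_zero] at hS
      exact dvd_sub hS (by exact_mod_cast hpn)
  · rintro ⟨p, hp, hpQ, hpn, hpN⟩ ⟨-, h⟩
    obtain ⟨a, k, hpk, hnk⟩ := Nat.exists_eq_pow_mul_and_not_dvd hn.ne' p hp.ne_one
    obtain _ | a := a
    · simp_all
    have hS := hp.pow_dvd_S_add_ite hN hN2 (a := a) (k := Q * k) (by rw [hnk]; ring)
    rw [if_pos hpN, one_mul] at hS
    have hpow : p ^ (a + 1) ∣ n := ⟨k, hnk⟩
    have hSn : p ^ (a + 1) ∣ S (Q * n) (Q * n) :=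
      (h.dvd_iff (hpow.mul_left Q)).mpr hpow
    have h1 : (p : ℤ) ^ (a + 1) ∣ p ^ a * ((Q * k : ℕ) : ℤ) :=
      (dvd_add_right (by exact_mod_cast hSn)).mp hS
    rw [pow_succ] at h1
    have h2 : p ∣ Q * k := by
      exact_mod_cast (mul_dvd_mul_iff_left (pow_ne_zero a (by exact_mod_cast hp.ne_zero))).mp h1
    exact (hp.dvd_mul.mp h2).elim hpQ hpk

theorem complement_decomposition_of_dvd {Q : ℕ} (hQ : Q ≠ 0) (hQ2 : Even Q) (hQ5 : ¬ 5 ∣ Q)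
    (hQp : ∀ p, p.Prime → p ∣ Q → p ∣ Q / p + 1 ∧ p - 1 ∣ Q * 5) :
    {n : ℕ | 0 < n ∧ 5 ∣ n} \ Nset Q = ⋃ d ∈ Nat.divisors Q, (W1 d Q ∪ W2 d Q) := by
  have key : ∀ n, 0 < n → 5 ∣ n →
      (n ∉ Nset Q ↔ ∃ p, p.Prime ∧ ¬ p ∣ Q ∧ p ∣ n ∧ p - 1 ∣ Q * n) := fun n hn h5 =>
    notMem_Nset_iff hQ hn hQ2 fun p hp hpQ =>
      ⟨(hQp p hp hpQ).1, (hQp p hp hpQ).2.trans (mul_dvd_mul_left Q h5)⟩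
  have h5p : Nat.Prime 5 := by norm_num
  ext n
  simp only [Set.mem_sdiff, Set.mem_ofPred_eq, Set.mem_iUnion, Nat.mem_divisors, exists_prop,
    Set.mem_union]
  constructor
  · rintro ⟨⟨hn, h5⟩, hN⟩
    obtain ⟨p, hp, hpQ, hpn, hpN⟩ := (key n hn h5).mp hN
    have hdp : Q.gcd (p - 1) ∣ p - 1 := Nat.gcd_dvd_right _ _
    have hp1 : 0 < p - 1 := Nat.sub_pos_of_lt hp.one_lt
    obtain ⟨e, he⟩ := hdp
    have hg : 0 < Q.gcd (p - 1) := Nat.gcd_pos_of_pos_right _ hp1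
    have hdiv : p * (p - 1) / Q.gcd (p - 1) = p * e := by
      rw [Nat.mul_div_assoc _ (Nat.gcd_dvd_right _ _)]
      congr 1
      exact Nat.div_eq_of_eq_mul_right hg he
    have hen : e ∣ n := by
      have h1 := Nat.coprime_div_gcd_div_gcd hg
      rw [Nat.div_eq_of_eq_mul_right hg he] at h1
      refine h1.symm.dvd_of_dvd_mul_left (Nat.dvd_of_mul_dvd_mul_left hg ?_)
      rw [← he, ← mul_assoc, Nat.mul_div_cancel' (Nat.gcd_dvd_left _ _)]
      exact hpN
    have he0 : 0 < e := Nat.pos_of_ne_zero (by rintro rfl; lia)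
    have hcop : Nat.Coprime p e := Nat.coprime_of_lt_prime he0.ne'
      (lt_of_le_of_lt (Nat.le_of_dvd hp1 ⟨_, he.trans (mul_comm _ _)⟩)
        (Nat.sub_lt hp.pos one_pos)) hp
    have hpe : p * e ∣ n := hcop.mul_dvd_of_dvd_of_dvd hpn hen
    refine ⟨Q.gcd (p - 1), ⟨Nat.gcd_dvd_left _ _, hQ⟩, ?_⟩
    by_cases h5p1 : 5 ∣ p * (p - 1)
    · obtain ⟨K, hK⟩ := hpe
      exact Or.inl ⟨p, K, hp, hpQ, h5p1, Nat.gcd_dvd_right _ _,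
        Nat.pos_of_ne_zero (by rintro rfl; lia), by rw [hdiv, hK, mul_comm]⟩
    · have h5pe : Nat.Coprime 5 (p * e) := by
        rw [h5p.coprime_iff_not_dvd]
        exact fun h => h5p1 (h.trans (mul_dvd_mul_left p ⟨_, he.trans (mul_comm _ _)⟩))
      obtain ⟨K, hK⟩ := h5pe.mul_dvd_of_dvd_of_dvd h5 hpe
      exact Or.inr ⟨p, K, hp, hpQ, h5p1, Nat.gcd_dvd_right _ _,
        Nat.pos_of_ne_zero (by rintro rfl; lia), by rw [hdiv, hK]; ring⟩
  · suffices H : ∀ d p K, d ∣ Q → p.Prime → ¬ p ∣ Q → d ∣ p - 1 → 0 < K →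
        5 ∣ K * (p * (p - 1) / d) → (0 < K * (p * (p - 1) / d) ∧ 5 ∣ K * (p * (p - 1) / d)) ∧
          K * (p * (p - 1) / d) ∉ Nset Q by
      rintro ⟨d, ⟨hdQ, -⟩, ⟨p, K, hp, hpQ, h5, hd, hK, rfl⟩ | ⟨p, K, hp, hpQ, h5, hd, hK, rfl⟩⟩
      · refine H d p K hdQ hp hpQ hd hK (Dvd.dvd.mul_left ?_ K)
        rw [← Nat.mul_div_cancel' (hd.mul_left p)] at h5
        exact (h5p.dvd_mul.mp h5).resolve_left fun h => hQ5 (h.trans hdQ)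
      · exact H d p (5 * K) hdQ hp hpQ hd (by lia) ⟨K * (p * (p - 1) / d), by ring⟩
    intro d p K hdQ hp hpQ hd hK h5
    have hp1 : 0 < p - 1 := Nat.sub_pos_of_lt hp.one_lt
    obtain ⟨e, he⟩ := hd
    have hd0 : 0 < d := Nat.pos_of_ne_zero (by rintro rfl; lia)
    have he0 : 0 < e := Nat.pos_of_ne_zero (by rintro rfl; lia)
    have hdiv : p * (p - 1) / d = p * e := by
      rw [Nat.mul_div_assoc _ ⟨e, he⟩, Nat.div_eq_of_eq_mul_right hd0 he]
    rw [hdiv] at h5 ⊢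
    have hpos : 0 < K * (p * e) := Nat.mul_pos hK (Nat.mul_pos hp.pos he0)
    refine ⟨⟨hpos, h5⟩, (key _ hpos h5).mpr ⟨p, hp, hpQ, ⟨K * e, by ring⟩, ?_⟩⟩
    rw [he]
    exact mul_dvd_mul hdQ ⟨K * p, by ring⟩

theorem complement_decomposition_47058_2214502422 :
    ∀ Q ∈ ({47058, 2214502422} : Set ℕ),
      {n : ℕ | 0 < n ∧ 5 ∣ n} \ Nset Q =
        ⋃ d ∈ Nat.divisors Q, (W1 d Q ∪ W2 d Q) := by
  have hprime : ∀ p q : ℕ, p.Prime → q.Prime → p ∣ q → p = q := fun p q hp hq =>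
    (Nat.prime_dvd_prime_iff_eq hp hq).mp
  rintro Q (rfl | rfl) <;>
    refine complement_decomposition_of_dvd (by norm_num) (by decide) (by norm_num) ?_ <;>
    intro p hp hpQ
  · rw [show 47058 = 2 * 3 * 11 * 23 * 31 by norm_num] at hpQ
    simp only [hp.dvd_mul] at hpQ
    rcases hpQ with (((h | h) | h) | h) | h <;>
      obtain rfl := hprime p _ hp (by norm_num) h <;> norm_num
  · rw [show 2214502422 = 2 * 3 * 11 * 23 * 31 * 47059 by norm_num] at hpQ
    simp only [hp.dvd_mul] at hpQ
    rcases hpQ with ((((h | h) | h) | h) | h) | h <;>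
      obtain rfl := hprime p _ hp (by norm_num) h <;> norm_num
end

section
/- Let (a_k)_{k≥1} and (c_k)_{k≥1} be sequences of positive integers, and for each k let B_k := { a_k + (s-1)·c_k : s a positive integer } be the arithmetic progression with first term a_k and common difference c_k. If the series ∑_{k=1}^{∞} 1/c_k converges and the set A := {a_k : k ≥ 1} has asymptotic density zero, then the union ⋃_{k=1}^{∞} B_k has an asymptotic density. -/
/-- A set `A` of positive integers has asymptotic density `δ` if
`card (A ∩ [1, N]) / N → δ` as `N → ∞`. -/
def HasDensity (A : Set ℕ) (δ : ℝ) : Prop :=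
  Filter.Tendsto (fun N : ℕ => ((A ∩ Set.Icc 1 N).ncard : ℝ) / N)
    Filter.atTop (nhds δ)

open Filter Topology

theorem exists_tendsto_of_eventually_close (f : ℕ → ℝ)
    (h : ∀ ε > 0, ∃ d, ∀ᶠ N in atTop, |f N - d| < ε) :
    ∃ δ, Tendsto f atTop (𝓝 δ) := by
  apply cauchySeq_tendsto_of_complete
  rw [Metric.cauchySeq_iff]
  intro ε hε
  obtain ⟨d, hd⟩ := h (ε / 2) (by linarith)
  obtain ⟨M, hM⟩ := eventually_atTop.1 hd
  refine ⟨M, fun m hm n hn => ?_⟩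
  have h1 := abs_lt.1 (hM m hm)
  have h2 := abs_lt.1 (hM n hn)
  rw [Real.dist_eq, abs_lt]
  constructor <;> linarith [h1.1, h1.2, h2.1, h2.2]

theorem exists_bound_of_eventually_periodic (h : ℕ → ℝ) (P m : ℕ) (hP : 0 < P)
    (hper : ∀ N, m ≤ N → h (N + P) = h N) : ∃ C, ∀ N, |h N| ≤ C := by
  refine ⟨∑ i ∈ Finset.range (m + P), |h i|, fun N => ?_⟩
  induction N using Nat.strong_induction_on with
  | _ N ih =>
    by_cases hN : N < m + P
    · exact Finset.single_le_sum (f := fun i => |h i|) (fun i _ => abs_nonneg _)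
        (Finset.mem_range.2 hN)
    · have h1 := hper (N - P) (by omega)
      rw [Nat.sub_add_cancel (by omega)] at h1
      rw [h1]
      exact ih _ (by omega)

open Classical in
theorem ncard_inter_Icc (S : Set ℕ) (N : ℕ) :
    (S ∩ Set.Icc 1 N).ncard = ((Finset.Icc 1 N).filter (· ∈ S)).card := by
  rw [← Set.ncard_coe_finset]
  congr 1
  ext x
  simp only [Set.mem_inter_iff, Set.mem_Icc, Finset.coe_filter, Finset.mem_Icc, Set.mem_ofPred_eq,
    and_comm]

open Classical in
theorem ncard_inter_Icc_succ (S : Set ℕ) (N : ℕ) :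
    (S ∩ Set.Icc 1 (N + 1)).ncard = (S ∩ Set.Icc 1 N).ncard + if N + 1 ∈ S then 1 else 0 := by
  rw [ncard_inter_Icc, ncard_inter_Icc, Finset.card_filter, Finset.card_filter,
    Finset.sum_Icc_succ_top (by omega)]

/-- A set of naturals is eventually periodic if membership is invariant under translation by
some positive period, from some point on. -/
def EventuallyPeriodic (S : Set ℕ) : Prop :=
  ∃ P m : ℕ, 0 < P ∧ ∀ n, m ≤ n → (n + P ∈ S ↔ n ∈ S)

theorem EventuallyPeriodic.hasDensity {S : Set ℕ} (hS : EventuallyPeriodic S) :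
    ∃ δ, HasDensity S δ := by
  classical
  obtain ⟨P, m, hP, hper⟩ := hS
  set g : ℕ → ℝ := fun N => ((S ∩ Set.Icc 1 N).ncard : ℝ) with hg
  have hsucc : ∀ N, g (N + 1) = g N + if N + 1 ∈ S then 1 else 0 := by
    intro N
    simp only [hg, ncard_inter_Icc_succ S N]
    push_cast
    rfl
  set D : ℝ := g (m + P) - g m with hD
  have hconst : ∀ N, m ≤ N → g (N + P) - g N = D := by
    intro N hN
    induction N, hN using Nat.le_induction with
    | base => rfl
    | succ N hN ih =>
      have h1 := hper (N + 1) (by omega)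
      rw [show N + 1 + P = N + P + 1 by ring] at h1 ⊢
      rw [hsucc, hsucc, ← ih]
      simp only [h1]
      ring
  have hP' : (P : ℝ) ≠ 0 := by positivity
  obtain ⟨C, hC⟩ := exists_bound_of_eventually_periodic (fun N => g N - N * (D / P)) P m hP (by
    intro N hN
    have := hconst N hN
    push_cast
    field_simp
    linear_combination (P : ℝ) * this)
  refine ⟨D / P, ?_⟩
  have hlim : Tendsto (fun N : ℕ => (g N - N * (D / P)) / N) atTop (𝓝 0) := by
    apply squeeze_zero_norm (a := fun N : ℕ => C / N)
    · intro N
      rw [norm_div, Real.norm_eq_abs, Real.norm_natCast]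
      gcongr
      exact hC N
    · exact tendsto_const_div_atTop_nhds_zero_nat C
  have h2 := hlim.add_const (D / P)
  rw [zero_add] at h2
  refine h2.congr' ?_
  filter_upwards [eventually_gt_atTop 0] with N hN
  have : (N : ℝ) ≠ 0 := by positivity
  simp only [hg]
  field_simp
  ring

theorem EventuallyPeriodic.empty : EventuallyPeriodic ∅ := ⟨1, 0, by simp⟩

theorem mem_add_mul_period_iff {S : Set ℕ} {P m : ℕ}
    (h : ∀ n, m ≤ n → (n + P ∈ S ↔ n ∈ S)) (j n : ℕ) (hn : m ≤ n) :
    n + P * j ∈ S ↔ n ∈ S := by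
  induction j with
  | zero => simp
  | succ j ih => rw [← ih, mul_add, mul_one, ← add_assoc, h _ (le_add_right hn)]

theorem EventuallyPeriodic.union {S T : Set ℕ} (hS : EventuallyPeriodic S)
    (hT : EventuallyPeriodic T) : EventuallyPeriodic (S ∪ T) := by
  obtain ⟨P, m, hP, h⟩ := hS
  obtain ⟨Q, l, hQ, h'⟩ := hT
  refine ⟨P * Q, max m l, by positivity, fun n hn => ?_⟩
  have h1 := mem_add_mul_period_iff h Q n (le_trans (le_max_left _ _) hn)
  have h2 := mem_add_mul_period_iff h' P n (le_trans (le_max_right _ _) hn)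
  rw [mul_comm] at h2
  simp [h1, h2]

theorem eventuallyPeriodic_biUnion (B : ℕ → Set ℕ) (hB : ∀ k, EventuallyPeriodic (B k))
    (s : Finset ℕ) : EventuallyPeriodic (⋃ k ∈ s, B k) := by
  classical
  induction s using Finset.induction_on with
  | empty => simpa using EventuallyPeriodic.empty
  | insert k s _ ih =>
    rw [Finset.set_biUnion_insert]
    exact (hB k).union ih

theorem eventuallyPeriodic_arithmeticProgression (a c : ℕ) (hc : 0 < c) :
    EventuallyPeriodic {m | ∃ s : ℕ, 0 < s ∧ m = a + (s - 1) * c} := by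
  refine ⟨c, a, hc, fun n hn => ⟨?_, ?_⟩⟩
  · rintro ⟨s, hs, h⟩
    obtain ⟨t, rfl⟩ : ∃ t, s = t + 1 := ⟨s - 1, by omega⟩
    rcases t with _ | t
    · simp at h
      omega
    · refine ⟨t + 1, by omega, ?_⟩
      simp only [Nat.add_sub_cancel, add_mul, one_mul] at h ⊢
      omega
  · rintro ⟨s, hs, h⟩
    obtain ⟨t, rfl⟩ : ∃ t, s = t + 1 := ⟨s - 1, by omega⟩
    refine ⟨t + 2, by omega, ?_⟩
    simp only [Nat.add_sub_cancel, Nat.add_succ_sub_one, add_mul, one_mul] at h ⊢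
    omega

theorem finite_setOf_le_of_summable_one_div {c : ℕ → ℕ} (hc : ∀ k, 0 < c k)
    (hsum : Summable (fun k => (1 : ℝ) / c k)) (N : ℕ) : {k | c k ≤ N}.Finite := by
  have h := hsum.tendsto_cofinite_zero.eventually (gt_mem_nhds (show (0 : ℝ) < 1 / (N + 1) by
    positivity))
  refine (eventually_cofinite.1 h).subset fun k hk => ?_
  have h0 : (0 : ℝ) < c k := by exact_mod_cast hc k
  have h1 : (c k : ℝ) ≤ N := by exact_mod_cast hk
  simp only [Set.mem_ofPred_eq, not_lt]
  exact one_div_le_one_div_of_le h0 (by linarith)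

/-- Apart from the first terms and the progressions indexed by `s`, only progressions with
difference at most `N` contribute elements up to `N`, and each contributes at most `N / c k`. -/
theorem ncard_iUnion_arithmeticProgression_le (a c : ℕ → ℕ) (hc : ∀ k, 0 < c k)
    (s t : Finset ℕ) (N : ℕ) (ht : ∀ k, k ∉ s → c k ≤ N → k ∈ t) :
    (((⋃ k : ℕ, {m | ∃ s : ℕ, 0 < s ∧ m = a k + (s - 1) * c k}) ∩ Set.Icc 1 N).ncard : ℝ) ≤
      ((⋃ k ∈ s, {m | ∃ s : ℕ, 0 < s ∧ m = a k + (s - 1) * c k}) ∩ Set.Icc 1 N).ncard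
      + ({n | ∃ k, n = a k} ∩ Set.Icc 1 N).ncard + N * ∑ k ∈ t, (1 : ℝ) / c k := by
  classical
  set R : Finset ℕ :=
    t.biUnion fun k => (Finset.Icc 1 (N / c k)).image fun j => a k + j * c k with hR
  have hsub : (⋃ k : ℕ, {m | ∃ s : ℕ, 0 < s ∧ m = a k + (s - 1) * c k}) ∩ Set.Icc 1 N ⊆
      ((⋃ k ∈ s, {m | ∃ s : ℕ, 0 < s ∧ m = a k + (s - 1) * c k}) ∩ Set.Icc 1 N) ∪
      ({n | ∃ k, n = a k} ∩ Set.Icc 1 N) ∪ (R : Set ℕ) := by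
    rintro x ⟨hx, hxN⟩
    obtain ⟨k, r, hr, rfl⟩ := Set.mem_iUnion.1 hx
    by_cases hk : k ∈ s
    · exact Or.inl (Or.inl ⟨Set.mem_biUnion hk ⟨r, hr, rfl⟩, hxN⟩)
    by_cases hr1 : r = 1
    · subst hr1
      exact Or.inl (Or.inr ⟨⟨k, by simp⟩, hxN⟩)
    right
    have hle : (r - 1) * c k ≤ N := le_trans (Nat.le_add_left _ _) hxN.2
    have hck : c k ≤ N := le_trans (Nat.le_mul_of_pos_left _ (by omega)) hle
    simp only [hR, Finset.coe_biUnion, Set.mem_iUnion, Finset.mem_coe, Finset.mem_image,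
      Finset.mem_Icc]
    exact ⟨k, ht k hk hck, r - 1, ⟨by omega, (Nat.le_div_iff_mul_le (hc k)).2 hle⟩, rfl⟩
  have hcard : (R.card : ℝ) ≤ N * ∑ k ∈ t, (1 : ℝ) / c k := by
    have h1 : R.card ≤ ∑ k ∈ t, N / c k :=
      Finset.card_biUnion_le.trans (Finset.sum_le_sum fun k _ =>
        Finset.card_image_le.trans (by simp))
    calc (R.card : ℝ) ≤ ((∑ k ∈ t, N / c k : ℕ) : ℝ) := by exact_mod_cast h1
      _ = ∑ k ∈ t, ((N / c k : ℕ) : ℝ) := by push_cast; rfl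
      _ ≤ ∑ k ∈ t, (N : ℝ) * (1 / c k) := by
        refine Finset.sum_le_sum fun k _ => ?_
        rw [mul_one_div]
        exact Nat.cast_div_le
      _ = _ := by rw [Finset.mul_sum]
  have hfin : ∀ S : Set ℕ, (S ∩ Set.Icc 1 N).Finite := fun S =>
    (Set.finite_Icc 1 N).subset Set.inter_subset_right
  have h2 := (Set.ncard_le_ncard hsub (((hfin _).union (hfin _)).union R.finite_toSet)).trans
    ((Set.ncard_union_le _ _).trans (Nat.add_le_add_right (Set.ncard_union_le _ _) _))
  rw [Set.ncard_coe_finset] at h2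
  have h3 := (Nat.cast_le (α := ℝ)).2 h2
  push_cast at h3
  linarith

theorem union_of_APs_has_density (a c : ℕ → ℕ)
    (ha : ∀ k, 0 < a k) (hc : ∀ k, 0 < c k)
    (hsum : Summable (fun k => (1 : ℝ) / c k))
    (hA : HasDensity {n | ∃ k, n = a k} 0) :
    ∃ δ : ℝ, HasDensity (⋃ k : ℕ, {m | ∃ s : ℕ, 0 < s ∧ m = a k + (s - 1) * c k}) δ := by
  classical
  apply exists_tendsto_of_eventually_close
  intro ε hε
  obtain ⟨s, hs⟩ := summable_iff_vanishing_norm.1 hsum (ε / 3) (by linarith)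
  obtain ⟨d, hd⟩ := (eventuallyPeriodic_biUnion _
    (fun k => eventuallyPeriodic_arithmeticProgression (a k) (c k) (hc k)) s).hasDensity
  refine ⟨d, ?_⟩
  filter_upwards [Metric.tendsto_nhds.1 hd (ε / 3) (by linarith),
    Metric.tendsto_nhds.1 hA (ε / 3) (by linarith), eventually_gt_atTop 0] with N h1 h2 hN
  have hN' : (0 : ℝ) < N := by exact_mod_cast hN
  set t : Finset ℕ := (finite_setOf_le_of_summable_one_div hc hsum N).toFinset \ s with ht
  have hU := ncard_iUnion_arithmeticProgression_le a c hc s t N (by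
    intro k hk hck
    simp [ht, hk, hck])
  have hsmall := (abs_lt.1 (hs t Finset.sdiff_disjoint)).2
  have hL : (((⋃ k ∈ s, {m | ∃ s : ℕ, 0 < s ∧ m = a k + (s - 1) * c k}) ∩
      Set.Icc 1 N).ncard : ℝ) ≤
      ((⋃ k : ℕ, {m | ∃ s : ℕ, 0 < s ∧ m = a k + (s - 1) * c k}) ∩ Set.Icc 1 N).ncard := by
    exact_mod_cast Set.ncard_le_ncard
      (Set.inter_subset_inter_left _ (Set.iUnion₂_subset_iUnion _ _))
      ((Set.finite_Icc 1 N).subset Set.inter_subset_right)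
  rw [Real.dist_eq, abs_lt] at h1 h2
  have hL' := div_le_div_of_nonneg_right hL hN'.le
  have hU' := div_le_div_of_nonneg_right hU hN'.le
  rw [add_div, add_div, mul_div_cancel_left₀ _ hN'.ne'] at hU'
  rw [abs_lt]
  constructor <;> linarith [h1.1, h1.2, h2.1, h2.2]
end
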